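/- Let F = (X_n, K_n, π_n)_{n≥1} be a family of irreducible birth and death chains on X_n = {0,1,...,n} and F_c the family of associated continuous-time chains. For a ∈ (0,1), let M_n(a) ∈ X_n satisfy π_n([0,M_n(a)]) ≥ a and π_n([M_n(a),n]) ≥ 1−a, and set u_n(a) = E_0 τ̃^{(n)}_{M_n(a)}, v_n(a)² = Var_0 τ̃^{(n)}_{M_n(a)}, and (in discrete time) w_n(a)² = Var_0 τ^{(n)}_{M_n(a)}. If F_c^L has a total variation cutoff and b_n > 0 is a sequence satisfying b_n = o(u_n(a)) and v_n(a) = O(b_n) for all a ∈ (0,1), then F_c^L has a (u_n(a), b_n) total variation cutoff for each a ∈ (0,1). The same statement holds for the discrete-time family F^L, under the additional assumptions inf_{n,i} K_n(i,i) > 0 and inf_n b_n > 0, with w_n(a) in place of v_n(a). -/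

import Mathlib

open scoped BigOperators
open Filter Matrix Polynomial MeasureTheory

noncomputable section

/-- An irreducible birth and death chain on `{0,1,...,n}`, together with its
(unique) stationary distribution. -/
structure BDChain (n : ℕ) where
  K : Matrix (Fin (n + 1)) (Fin (n + 1)) ℝ
  pi : Fin (n + 1) → ℝ
  K_nonneg : ∀ i j, 0 ≤ K i j
  K_rowSum : ∀ i, ∑ j, K i j = 1
  K_tridiag : ∀ i j : Fin (n + 1), 1 < |(i : ℤ) - (j : ℤ)| → K i j = 0
  K_irred : ∀ i : ℕ, ∀ h : i < n,
    0 < K ⟨i, by omega⟩ ⟨i + 1, by omega⟩ ∧ 0 < K ⟨i + 1, by omega⟩ ⟨i, by omega⟩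
  pi_pos : ∀ i, 0 < pi i
  pi_sum : ∑ i, pi i = 1
  pi_stat : ∀ j, ∑ i, pi i * K i j = pi j

namespace BDChain

variable {n : ℕ}

/-- `π([0,M])` -/
def piLow (c : BDChain n) (M : Fin (n + 1)) : ℝ :=
  ∑ ℓ : Fin (n + 1), if ℓ ≤ M then c.pi ℓ else 0

/-- `π([M,n])` -/
def piHigh (c : BDChain n) (M : Fin (n + 1)) : ℝ :=
  ∑ ℓ : Fin (n + 1), if M ≤ ℓ then c.pi ℓ else 0

/-- `π([a,b])` -/
def piInt (c : BDChain n) (a b : Fin (n + 1)) : ℝ :=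
  ∑ ℓ : Fin (n + 1), if a ≤ ℓ ∧ ℓ ≤ b then c.pi ℓ else 0

/-- The substochastic matrix of the chain killed at state `i`. -/
def killed (c : BDChain n) (i : Fin (n + 1)) : Matrix (Fin (n + 1)) (Fin (n + 1)) ℝ :=
  Matrix.of fun x y => if x = i ∨ y = i then 0 else c.K x y

/-- `P_j(τ_i > m)`, where `τ_i` is the discrete-time hitting time of state `i`. -/
def hitSurv (c : BDChain n) (i j : Fin (n + 1)) (m : ℕ) : ℝ :=
  if j = i then 0 else ∑ y, (c.killed i ^ m) j y

/-- `P_j(τ̃_i > t)`, where `τ̃_i` is the continuous-time hitting time of state `i`. -/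
def hitSurvC (c : BDChain n) (i j : Fin (n + 1)) (t : ℝ) : ℝ :=
  ∑' m : ℕ, (Real.exp (-t) * t ^ m / m.factorial) * c.hitSurv i j m

/-- `E_j τ_i` -/
def hitMean (c : BDChain n) (i j : Fin (n + 1)) : ℝ :=
  ∑' m : ℕ, c.hitSurv i j m

/-- `Var_j τ_i` -/
def hitVar (c : BDChain n) (i j : Fin (n + 1)) : ℝ :=
  (∑' m : ℕ, (2 * (m : ℝ) + 1) * c.hitSurv i j m) - (c.hitMean i j) ^ 2

/-- `E_j τ̃_i` -/
def hitMeanC (c : BDChain n) (i j : Fin (n + 1)) : ℝ :=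
  ∫ t in Set.Ioi (0 : ℝ), c.hitSurvC i j t

/-- `Var_j τ̃_i` -/
def hitVarC (c : BDChain n) (i j : Fin (n + 1)) : ℝ :=
  (∫ t in Set.Ioi (0 : ℝ), 2 * t * c.hitSurvC i j t) - (c.hitMeanC i j) ^ 2

/-- The substochastic matrix of the chain killed at states `i` and `k`. -/
def killed2 (c : BDChain n) (i k : Fin (n + 1)) : Matrix (Fin (n + 1)) (Fin (n + 1)) ℝ :=
  Matrix.of fun x y => if x = i ∨ x = k ∨ y = i ∨ y = k then 0 else c.K x y

/-- `P_j(min{τ_i, τ_k} > m)` -/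
def hitSurv2 (c : BDChain n) (i k j : Fin (n + 1)) (m : ℕ) : ℝ :=
  if j = i ∨ j = k then 0 else ∑ y, (c.killed2 i k ^ m) j y

/-- `E_j min{τ_i, τ_k}` -/
def hitMean2 (c : BDChain n) (i k j : Fin (n + 1)) : ℝ :=
  ∑' m : ℕ, c.hitSurv2 i k j m

/-- `E_j min{τ̃_i, τ̃_k}` -/
def hitMean2C (c : BDChain n) (i k j : Fin (n + 1)) : ℝ :=
  ∫ t in Set.Ioi (0 : ℝ),
    ∑' m : ℕ, (Real.exp (-t) * t ^ m / m.factorial) * c.hitSurv2 i k j m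

/-- The continuous-time kernel `H_t(x,y) = e^{-t(I-K)}(x,y)`. -/
def Ht (c : BDChain n) (t : ℝ) (x y : Fin (n + 1)) : ℝ :=
  ∑' m : ℕ, (Real.exp (-t) * t ^ m / m.factorial) * (c.K ^ m) x y

/-- Discrete-time total variation distance from starting state `x` at time `m`. -/
def dTV (c : BDChain n) (x : Fin (n + 1)) (m : ℕ) : ℝ :=
  ⨆ A : Finset (Fin (n + 1)), (∑ y ∈ A, (c.K ^ m) x y - ∑ y ∈ A, c.pi y)

/-- Continuous-time total variation distance from starting state `x` at time `t`. -/
def dTVC (c : BDChain n) (x : Fin (n + 1)) (t : ℝ) : ℝ :=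
  ⨆ A : Finset (Fin (n + 1)), (∑ y ∈ A, c.Ht t x y - ∑ y ∈ A, c.pi y)

/-- Maximum (over starting states) discrete-time total variation distance. -/
def dTVMax (c : BDChain n) (m : ℕ) : ℝ := ⨆ x, c.dTV x m

/-- Maximum (over starting states) continuous-time total variation distance. -/
def dTVMaxC (c : BDChain n) (t : ℝ) : ℝ := ⨆ x, c.dTVC x t

/-- Discrete-time separation from starting state `x` at time `m`. -/
def sep (c : BDChain n) (x : Fin (n + 1)) (m : ℕ) : ℝ :=
  ⨆ y, (1 - (c.K ^ m) x y / c.pi y)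

/-- Continuous-time separation from starting state `x` at time `t`. -/
def sepC (c : BDChain n) (x : Fin (n + 1)) (t : ℝ) : ℝ :=
  ⨆ y, (1 - c.Ht t x y / c.pi y)

end BDChain

/-- Discrete-time `ε`-mixing time for a distance profile `d`. -/
def mixD (d : ℕ → ℝ) (ε : ℝ) : ℕ := sInf {m : ℕ | d m ≤ ε}

/-- Continuous-time `ε`-mixing time for a distance profile `d`. -/
def mixC (d : ℝ → ℝ) (ε : ℝ) : ℝ := sInf {t : ℝ | 0 ≤ t ∧ d t ≤ ε}

/-- The set of (real) eigenvalues of a square matrix. -/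
def eigSet {ι : Type*} [Fintype ι] (M : Matrix ι ι ℝ) : Set ℝ :=
  {x | ∃ v : ι → ℝ, v ≠ 0 ∧ M.mulVec v = x • v}

/-- `l` is the smallest non-zero eigenvalue of `M`. -/
def IsSmallestNonzeroEig {ι : Type*} [Fintype ι] (M : Matrix ι ι ℝ) (l : ℝ) : Prop :=
  l ∈ eigSet M ∧ l ≠ 0 ∧ ∀ x ∈ eigSet M, x ≠ 0 → l ≤ x

/-- `l` is the smallest eigenvalue of `M`. -/
def IsSmallestEig {ι : Type*} [Fintype ι] (M : Matrix ι ι ℝ) (l : ℝ) : Prop :=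
  l ∈ eigSet M ∧ ∀ x ∈ eigSet M, l ≤ x

/-- The principal submatrix of `I - K` indexed by the states `0, 1, ..., M-1`. -/
def BDChain.subIK {n : ℕ} (c : BDChain n) (M : Fin (n + 1)) :
    Matrix (Fin (M : ℕ)) (Fin (M : ℕ)) ℝ :=
  Matrix.of fun a b =>
    (1 - c.K) (Fin.castLE M.isLt.le a) (Fin.castLE M.isLt.le b)

/-- A family of chains, with `ε ↦ n ↦ T ε n` the mixing time profile, presents a cutoff
with cutoff time `t`. -/
def cutoffWith (T : ℝ → ℕ → ℝ) (t : ℕ → ℝ) : Prop :=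
  ∀ ε ∈ Set.Ioo (0 : ℝ) 1, Filter.Tendsto (fun n => T ε n / t n) Filter.atTop (nhds 1)

/-- A family of chains presents a cutoff. -/
def hasCutoff (T : ℝ → ℕ → ℝ) : Prop :=
  ∃ t : ℕ → ℝ, (∀ n, 0 < t n) ∧ cutoffWith T t

/-- A family of chains presents a `(t_n, b_n)` cutoff. -/
def cutoffWindow (T : ℝ → ℕ → ℝ) (t b : ℕ → ℝ) : Prop :=
  (∀ᶠ n in Filter.atTop, 0 < t n) ∧ (∀ᶠ n in Filter.atTop, 0 < b n) ∧
  Filter.Tendsto (fun n => b n / t n) Filter.atTop (nhds 0) ∧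
  ∀ ε ∈ Set.Ioo (0 : ℝ) 1, ∃ C : ℝ, ∀ᶠ n in Filter.atTop, |T ε n - t n| ≤ C * b n

namespace BDChain

variable {n : ℕ}

/-- The cumulative stationary mass of the states at most `l`. -/
def cumMass (c : BDChain n) (l : ℕ) : ℝ :=
  ∑ k : Fin (n + 1), if (k : ℕ) ≤ l then c.pi k else 0

/-- The resistance of the edge between `l` and `l + 1`. -/
def edgeRes (c : BDChain n) (l : ℕ) : ℝ :=
  if h : l < n then (c.pi ⟨l, by omega⟩ * c.K ⟨l, by omega⟩ ⟨l + 1, by omega⟩)⁻¹ else 0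

lemma sum_antisymm_tridiag (B : Fin (n + 1) → Fin (n + 1) → ℝ)
    (hB : ∀ i j : Fin (n + 1), 1 < |(i : ℤ) - (j : ℤ)| → B i j = 0)
    (hanti : ∀ i j, B i j = -B j i) (l : ℕ) (hl : l < n) :
    (∑ k : Fin (n + 1), if (k : ℕ) ≤ l then ∑ y, B k y else 0)
      = B ⟨l, by omega⟩ ⟨l + 1, by omega⟩ := by
  have h0 : (∑ k : Fin (n + 1), ∑ y : Fin (n + 1),
      if (k : ℕ) ≤ l ∧ (y : ℕ) ≤ l then B k y else 0) = 0 := by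
    have h1 : (∑ k : Fin (n + 1), ∑ y : Fin (n + 1),
        if (k : ℕ) ≤ l ∧ (y : ℕ) ≤ l then B k y else 0)
        = -(∑ k : Fin (n + 1), ∑ y : Fin (n + 1),
        if (k : ℕ) ≤ l ∧ (y : ℕ) ≤ l then B k y else 0) := by
      conv_lhs => rw [Finset.sum_comm]
      rw [← Finset.sum_neg_distrib]
      refine Finset.sum_congr rfl fun k _ => ?_
      rw [← Finset.sum_neg_distrib]
      refine Finset.sum_congr rfl fun y _ => ?_
      rw [hanti y k]
      by_cases h : (k : ℕ) ≤ l ∧ (y : ℕ) ≤ l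
      · rw [if_pos h, if_pos h.symm]
      · rw [if_neg h, if_neg (fun h' => h h'.symm), neg_zero]
    linarith
  have h2 : (∑ k : Fin (n + 1), ∑ y : Fin (n + 1),
      if (k : ℕ) ≤ l ∧ l < (y : ℕ) then B k y else 0)
      = B ⟨l, by omega⟩ ⟨l + 1, by omega⟩ := by
    rw [Finset.sum_eq_single ⟨l, by omega⟩]
    · rw [Finset.sum_eq_single ⟨l + 1, by omega⟩]
      · simp
      · intro y _ hy
        split_ifs with h
        · apply hB
          have : (y : ℕ) ≠ l + 1 := fun h' => hy (Fin.ext h')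
          rw [lt_abs]; simp only; omega
        · rfl
      · simp
    · intro k _ hk
      refine Finset.sum_eq_zero fun y _ => ?_
      split_ifs with h
      · apply hB
        have : (k : ℕ) ≠ l := fun h' => hk (Fin.ext h')
        rw [lt_abs]; omega
      · rfl
    · simp
  refine Eq.trans ?_ ((congrArg₂ (· + ·) h0 h2).trans (zero_add _))
  rw [← Finset.sum_add_distrib]
  refine Finset.sum_congr rfl fun k _ => ?_
  rw [← Finset.sum_add_distrib]
  by_cases hk : (k : ℕ) ≤ l
  · rw [if_pos hk]
    refine Finset.sum_congr rfl fun y _ => ?_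
    by_cases hy : (y : ℕ) ≤ l
    · rw [if_pos ⟨hk, hy⟩, if_neg (by omega), add_zero]
    · rw [if_neg (by omega), if_pos (by omega), zero_add]
  · simp [hk]

lemma edge_balance (c : BDChain n) (l : ℕ) (hl : l < n) :
    c.pi ⟨l, by omega⟩ * c.K ⟨l, by omega⟩ ⟨l + 1, by omega⟩
      = c.pi ⟨l + 1, by omega⟩ * c.K ⟨l + 1, by omega⟩ ⟨l, by omega⟩ := by
  have h := sum_antisymm_tridiag (fun i j => c.pi i * c.K i j - c.pi j * c.K j i)
    (fun i j hij => by
      have h1 := c.K_tridiag i j hij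
      have h2 := c.K_tridiag j i (by rwa [abs_sub_comm])
      simp [h1, h2]) (fun i j => by ring) l hl
  have h0 : ∀ k, ∑ y, (c.pi k * c.K k y - c.pi y * c.K y k) = 0 := by
    intro k
    rw [Finset.sum_sub_distrib, ← Finset.mul_sum, c.K_rowSum, c.pi_stat]; ring
  simp only [h0, ite_self, Finset.sum_const_zero] at h
  linarith

lemma detailed_balance (c : BDChain n) (i j : Fin (n + 1)) :
    c.pi i * c.K i j = c.pi j * c.K j i := by
  by_cases hij : 1 < |(i : ℤ) - (j : ℤ)|
  · rw [c.K_tridiag i j hij, c.K_tridiag j i (by rwa [abs_sub_comm])]; simp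
  · rw [not_lt, abs_le] at hij
    rcases lt_trichotomy (i : ℕ) (j : ℕ) with h | h | h
    · have := c.edge_balance i (by have := j.isLt; omega)
      have hj : j = ⟨(i : ℕ) + 1, by have := j.isLt; omega⟩ :=
        Fin.ext (by change (j : ℕ) = i + 1; omega)
      rw [hj]; exact this
    · rw [Fin.ext h]
    · have := c.edge_balance j (by have := i.isLt; omega)
      have hi : i = ⟨(j : ℕ) + 1, by have := i.isLt; omega⟩ :=
        Fin.ext (by change (i : ℕ) = j + 1; omega)
      rw [hi]; exact this.symm

lemma edgeRes_pos (c : BDChain n) (l : ℕ) (hl : l < n) : 0 < c.edgeRes l := by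
  rw [edgeRes, dif_pos hl]
  exact inv_pos.mpr (mul_pos (c.pi_pos _) (c.K_irred l hl).1)

lemma edgeRes_nonneg (c : BDChain n) (l : ℕ) : 0 ≤ c.edgeRes l := by
  by_cases hl : l < n
  · exact (c.edgeRes_pos l hl).le
  · rw [edgeRes, dif_neg hl]

/-- The increment of `f` over an edge is the resistance times the total flux through it. -/
lemma sub_eq_edgeRes_mul (c : BDChain n) (f : Fin (n + 1) → ℝ) (l : ℕ) (hl : l < n) :
    f ⟨l, by omega⟩ - f ⟨l + 1, by omega⟩ = c.edgeRes l *
      ∑ k : Fin (n + 1), if (k : ℕ) ≤ l then c.pi k * (f k - ∑ y, c.K k y * f y) else 0 := by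
  have h := sum_antisymm_tridiag (fun i j => c.pi i * c.K i j * (f i - f j))
    (fun i j hij => by simp [c.K_tridiag i j hij])
    (fun i j => by rw [c.detailed_balance i j]; ring) l hl
  have h0 : ∀ k, ∑ y, c.pi k * c.K k y * (f k - f y)
      = c.pi k * (f k - ∑ y, c.K k y * f y) := by
    intro k
    have : f k = ∑ y, c.K k y * f k := by rw [← Finset.sum_mul, c.K_rowSum, one_mul]
    conv_rhs => rw [this, ← Finset.sum_sub_distrib, Finset.mul_sum]
    exact Finset.sum_congr rfl fun y _ => by ring
  simp only [h0] at h
  rw [h, edgeRes, dif_pos hl]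
  have h1 := c.pi_pos ⟨l, by omega⟩
  have h2 := (c.K_irred l hl).1
  field_simp

lemma cumMass_mono (c : BDChain n) : Monotone c.cumMass := by
  intro a b hab
  refine Finset.sum_le_sum fun k _ => ?_
  have := (c.pi_pos k).le
  split_ifs <;> first | omega | linarith

lemma cumMass_le_one (c : BDChain n) (l : ℕ) : c.cumMass l ≤ 1 := by
  rw [← c.pi_sum]
  refine Finset.sum_le_sum fun k _ => ?_
  have := (c.pi_pos k).le
  split_ifs <;> linarith

lemma cumMass_nonneg (c : BDChain n) (l : ℕ) : 0 ≤ c.cumMass l :=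
  Finset.sum_nonneg fun k _ => by
    have := (c.pi_pos k).le
    split_ifs <;> linarith

lemma pi_le_cumMass (c : BDChain n) (k : Fin (n + 1)) : c.pi k ≤ c.cumMass k := by
  have := Finset.single_le_sum
    (f := fun x : Fin (n + 1) => if (x : ℕ) ≤ k then c.pi x else 0)
    (fun i _ => by have := (c.pi_pos i).le; split_ifs <;> linarith)
    (Finset.mem_univ k)
  simpa [cumMass] using this

/-- The mean crossing time of an edge, `edgeRes * cumMass`, is at least `1 / (1 - δ)` for a
chain with holding probabilities at least `δ`. -/
lemma one_le_mul_edgeRes_mul_cumMass (c : BDChain n) {δ : ℝ} (hδ : ∀ i, δ ≤ c.K i i)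
    (l : ℕ) (hl : l < n) : 1 ≤ (1 - δ) * (c.edgeRes l * c.cumMass l) := by
  have h1 := c.pi_pos ⟨l, by omega⟩
  have h2 := (c.K_irred l hl).1
  have h3 : c.K ⟨l, by omega⟩ ⟨l + 1, by omega⟩ ≤ 1 - δ := by
    have h := c.K_rowSum ⟨l, by omega⟩
    have h' := Finset.sum_le_sum_of_subset_of_nonneg
      (Finset.subset_univ {(⟨l, by omega⟩ : Fin (n + 1)), ⟨l + 1, by omega⟩})
      (f := fun j => c.K ⟨l, by omega⟩ j) (fun j _ _ => c.K_nonneg _ j)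
    rw [h, Finset.sum_pair (by simp [Fin.ext_iff])] at h'
    linarith [hδ ⟨l, by omega⟩]
  have h4 : c.pi ⟨l, by omega⟩ ≤ c.cumMass l := c.pi_le_cumMass ⟨l, by omega⟩
  rw [edgeRes, dif_pos hl]
  have h5 : (1 - δ) * ((c.pi ⟨l, by omega⟩ * c.K ⟨l, by omega⟩ ⟨l + 1, by omega⟩)⁻¹
      * c.cumMass l) = (1 - δ) * c.cumMass l /
      (c.pi ⟨l, by omega⟩ * c.K ⟨l, by omega⟩ ⟨l + 1, by omega⟩) := by
    field_simp
  rw [h5, le_div_iff₀ (mul_pos h1 h2)]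
  nlinarith

/-! ### Hitting times -/

/-- The variance of the continuous-time hitting time of `M` from `0`, as an explicit sum. -/
def varSum (c : BDChain n) (M : ℕ) : ℝ :=
  ∑ l ∈ Finset.range M,
    (2 * c.edgeRes l * ∑ i ∈ Finset.range (l + 1), c.edgeRes i * c.cumMass i ^ 2
      - (c.edgeRes l * c.cumMass l) ^ 2)

lemma sum_sq_le_varSum (c : BDChain n) (M : ℕ) :
    ∑ l ∈ Finset.range M, (c.edgeRes l * c.cumMass l) ^ 2 ≤ c.varSum M := by
  refine Finset.sum_le_sum fun l _ => ?_
  rw [Finset.sum_range_succ]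
  have h1 := c.edgeRes_nonneg l
  have h2 : 0 ≤ ∑ i ∈ Finset.range l, c.edgeRes i * c.cumMass i ^ 2 :=
    Finset.sum_nonneg fun i _ => mul_nonneg (c.edgeRes_nonneg i) (sq_nonneg _)
  nlinarith [mul_nonneg h1 h2]

lemma varSum_nonneg (c : BDChain n) (M : ℕ) : 0 ≤ c.varSum M :=
  (Finset.sum_nonneg fun _ _ => sq_nonneg _).trans (c.sum_sq_le_varSum M)

lemma sq_cumMass_mul_le_varSum (c : BDChain n) (j M : ℕ) :
    (c.cumMass j * ∑ l ∈ Finset.Ico j M, c.edgeRes l) ^ 2 ≤ c.varSum M := by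
  rcases le_total M j with hjM | hjM
  · simpa [Finset.Ico_eq_empty_of_le hjM] using c.varSum_nonneg M
  induction M, hjM using Nat.le_induction with
  | base => simpa using c.varSum_nonneg j
  | succ M hjM ih =>
    have h0 := c.edgeRes_nonneg M
    have hP := c.cumMass_nonneg j
    have hPM := c.cumMass_mono hjM
    have hS : 0 ≤ ∑ l ∈ Finset.Ico j M, c.edgeRes l :=
      Finset.sum_nonneg fun i _ => c.edgeRes_nonneg i
    have hR : c.cumMass j ^ 2 * ∑ l ∈ Finset.Ico j M, c.edgeRes l
        ≤ ∑ i ∈ Finset.range M, c.edgeRes i * c.cumMass i ^ 2 := by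
      rw [Finset.mul_sum, Finset.range_eq_Ico]
      calc _ ≤ ∑ i ∈ Finset.Ico j M, c.edgeRes i * c.cumMass i ^ 2 := by
            refine Finset.sum_le_sum fun i hi => ?_
            have := c.cumMass_mono (Finset.mem_Ico.mp hi).1
            rw [mul_comm]
            exact mul_le_mul_of_nonneg_left (pow_le_pow_left₀ hP this 2) (c.edgeRes_nonneg i)
        _ ≤ _ := Finset.sum_le_sum_of_subset_of_nonneg
            (Finset.Ico_subset_Ico_left (Nat.zero_le j))
            fun i _ _ => mul_nonneg (c.edgeRes_nonneg i) (sq_nonneg _)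
    rw [varSum, Finset.sum_range_succ, ← varSum, Finset.sum_Ico_succ_top hjM,
      Finset.sum_range_succ _ M]
    have h1 := mul_le_mul_of_nonneg_left hR h0
    have h2 := mul_le_mul_of_nonneg_left (pow_le_pow_left₀ hP hPM 2) (mul_nonneg h0 h0)
    nlinarith

lemma hitSurv_self (c : BDChain n) (M : Fin (n + 1)) (m : ℕ) : c.hitSurv M M m = 0 := by
  simp [hitSurv]

lemma hitSurv_zero (c : BDChain n) {M x : Fin (n + 1)} (h : x ≠ M) : c.hitSurv M x 0 = 1 := by
  simp [hitSurv, h, Matrix.one_apply]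

lemma hitSurv_succ (c : BDChain n) {M x : Fin (n + 1)} (h : x ≠ M) (m : ℕ) :
    c.hitSurv M x (m + 1) = ∑ y, c.K x y * c.hitSurv M y m := by
  rw [hitSurv, if_neg h, pow_succ']
  simp only [Matrix.mul_apply]
  rw [Finset.sum_comm]
  refine Finset.sum_congr rfl fun y _ => ?_
  rw [← Finset.mul_sum, hitSurv]
  by_cases hy : y = M <;> simp [killed, h, hy]

lemma hitSurv_nonneg (c : BDChain n) (M x : Fin (n + 1)) (m : ℕ) : 0 ≤ c.hitSurv M x m := by
  induction m generalizing x with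
  | zero =>
    by_cases h : x = M
    · rw [h, hitSurv_self]
    · rw [hitSurv_zero c h]; norm_num
  | succ m ih =>
    by_cases h : x = M
    · rw [h, hitSurv_self]
    · rw [hitSurv_succ c h]
      exact Finset.sum_nonneg fun y _ => mul_nonneg (c.K_nonneg x y) (ih y)

lemma sum_K_mul_le (c : BDChain n) {f g : Fin (n + 1) → ℝ} (x : Fin (n + 1))
    (h : ∀ y, c.K x y ≠ 0 → f y ≤ g y) : ∑ y, c.K x y * f y ≤ ∑ y, c.K x y * g y := by
  refine Finset.sum_le_sum fun y _ => ?_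
  by_cases hK : c.K x y = 0
  · simp [hK]
  · exact mul_le_mul_of_nonneg_left (h y hK) (c.K_nonneg x y)

lemma hitSurv_le_one (c : BDChain n) (M x : Fin (n + 1)) (m : ℕ) : c.hitSurv M x m ≤ 1 := by
  induction m generalizing x with
  | zero =>
    by_cases h : x = M
    · rw [h, hitSurv_self]; norm_num
    · rw [hitSurv_zero c h]
  | succ m ih =>
    by_cases h : x = M
    · rw [h, hitSurv_self]; norm_num
    · rw [hitSurv_succ c h]
      refine (c.sum_K_mul_le x (g := fun _ => 1) fun y _ => ih y).trans ?_
      simp [c.K_rowSum]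

lemma hitSurv_add_le (c : BDChain n) (M : Fin (n + 1)) {N : ℕ} {ρ : ℝ}
    (hρ : ∀ x, c.hitSurv M x N ≤ ρ) (m : ℕ) (x : Fin (n + 1)) :
    c.hitSurv M x (N + m) ≤ ρ * c.hitSurv M x m := by
  induction m generalizing x with
  | zero =>
    by_cases h : x = M
    · simp [h, hitSurv_self]
    · rw [hitSurv_zero c h]; simpa using hρ x
  | succ m ih =>
    by_cases h : x = M
    · simp [h, hitSurv_self]
    · rw [← add_assoc, hitSurv_succ c h, hitSurv_succ c h, Finset.mul_sum]
      refine (c.sum_K_mul_le x fun y _ => ih y).trans (le_of_eq ?_)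
      exact Finset.sum_congr rfl fun y _ => by ring

lemma hitSurv_antitone (c : BDChain n) (M x : Fin (n + 1)) : Antitone (c.hitSurv M x) := by
  refine antitone_nat_of_succ_le fun m => ?_
  have := c.hitSurv_add_le M (N := 1) (fun x => c.hitSurv_le_one M x 1) m x
  rwa [one_mul, add_comm] at this

lemma hitSurv_lt_one (c : BDChain n) (M : Fin (n + 1)) (d : ℕ) (x : Fin (n + 1))
    (h1 : (x : ℕ) ≤ M + d) (h2 : (M : ℕ) ≤ x + d) : c.hitSurv M x d < 1 := by
  induction d generalizing x with
  | zero =>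
    have : x = M := Fin.ext (by omega)
    rw [this, hitSurv_self]; norm_num
  | succ d ih =>
    by_cases h : x = M
    · rw [h, hitSurv_self]; norm_num
    · have hne : (x : ℕ) ≠ M := fun h' => h (Fin.ext h')
      rw [hitSurv_succ c h, ← c.K_rowSum x]
      have key : ∃ y, 0 < c.K x y ∧ c.hitSurv M y d < 1 := by
        rcases lt_or_gt_of_ne hne with hlt | hgt
        · have hx : (x : ℕ) < n := by have := M.isLt; omega
          exact ⟨⟨x + 1, by omega⟩, (c.K_irred x hx).1,
            ih _ (by simp only; omega) (by simp only; omega)⟩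
        · have hx : (x : ℕ) - 1 < n := by have := x.isLt; omega
          have hx' : x = ⟨(x : ℕ) - 1 + 1, by omega⟩ := Fin.ext (by simp only; omega)
          refine ⟨⟨x - 1, by omega⟩, ?_, ih _ (by simp only; omega) (by simp only; omega)⟩
          have := (c.K_irred (x - 1) hx).2
          rwa [← hx'] at this
      obtain ⟨y, hy1, hy2⟩ := key
      refine Finset.sum_lt_sum (fun z _ => ?_) ⟨y, Finset.mem_univ _, ?_⟩
      · exact mul_le_of_le_one_right (c.K_nonneg x z) (c.hitSurv_le_one M z d)
      · nlinarith

lemma exists_hitSurv_le_geometric (c : BDChain n) (M : Fin (n + 1)) :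
    ∃ C θ : ℝ, 0 ≤ θ ∧ θ < 1 ∧ ∀ x m, c.hitSurv M x m ≤ C * θ ^ m := by
  have hN : n + 1 ≠ 0 := Nat.succ_ne_zero n
  obtain ⟨x₀, hx₀⟩ := Finite.exists_max fun x => c.hitSurv M x (n + 1)
  set ρ := max (c.hitSurv M x₀ (n + 1)) (1 / 2) with hρ
  have hρ0 : 0 < ρ := lt_max_of_lt_right (by norm_num)
  have hρ1 : ρ < 1 := max_lt
    (c.hitSurv_lt_one M _ x₀ (by have := x₀.isLt; omega) (by have := M.isLt; omega))
    (by norm_num)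
  have hρs : ∀ x, c.hitSurv M x (n + 1) ≤ ρ := fun x => (hx₀ x).trans (le_max_left _ _)
  set θ := ρ ^ (((n + 1 : ℕ) : ℝ)⁻¹) with hθ
  have hθN : θ ^ (n + 1) = ρ := Real.rpow_inv_natCast_pow hρ0.le hN
  have hθ0 : 0 < θ := Real.rpow_pos_of_pos hρ0 _
  have hθ1 : θ < 1 := Real.rpow_lt_one hρ0.le hρ1 (by positivity)
  refine ⟨ρ⁻¹, θ, hθ0.le, hθ1, fun x m => ?_⟩
  induction m using Nat.strong_induction_on with
  | _ m ih =>
    by_cases hm : m < n + 1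
    · refine (c.hitSurv_le_one M x m).trans ?_
      rw [← hθN, inv_mul_eq_div, one_le_div (by positivity)]
      exact pow_le_pow_of_le_one hθ0.le hθ1.le hm.le
    · obtain ⟨k, rfl⟩ := Nat.exists_eq_add_of_le (not_lt.mp hm)
      refine (c.hitSurv_add_le M hρs k x).trans ?_
      have := ih k (by omega)
      rw [pow_add, hθN]
      calc _ ≤ ρ * (ρ⁻¹ * θ ^ k) := mul_le_mul_of_nonneg_left this hρ0.le
        _ = _ := by ring

lemma summable_mul_hitSurv (c : BDChain n) (M x : Fin (n + 1)) :
    Summable fun m : ℕ => (m : ℝ) * c.hitSurv M x m := by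
  obtain ⟨C, θ, h0, h1, h⟩ := c.exists_hitSurv_le_geometric M
  have hs := (summable_pow_mul_geometric_of_norm_lt_one 1
    (r := θ) (by rwa [Real.norm_of_nonneg h0])).mul_left C
  refine Summable.of_nonneg_of_le (fun m => mul_nonneg m.cast_nonneg (c.hitSurv_nonneg M x m))
    (fun m => ?_) hs
  calc _ ≤ (m : ℝ) * (C * θ ^ m) := mul_le_mul_of_nonneg_left (h x m) m.cast_nonneg
    _ = _ := by ring

lemma summable_hitSurv (c : BDChain n) (M x : Fin (n + 1)) : Summable (c.hitSurv M x) := by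
  obtain ⟨C, θ, h0, h1, h⟩ := c.exists_hitSurv_le_geometric M
  exact Summable.of_nonneg_of_le (c.hitSurv_nonneg M x) (h x)
    ((summable_geometric_of_lt_one h0 h1).mul_left C)

lemma summable_succ_mul_hitSurv (c : BDChain n) (M x : Fin (n + 1)) :
    Summable fun m : ℕ => ((m : ℝ) + 1) * c.hitSurv M x m := by
  simpa [add_mul] using (c.summable_mul_hitSurv M x).add (c.summable_hitSurv M x)

/-- The Green potential of the mean hitting time, `E_x [τ (τ + 1)] / 2`. -/
def hitPot (c : BDChain n) (M x : Fin (n + 1)) : ℝ :=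
  ∑' m : ℕ, ((m : ℝ) + 1) * c.hitSurv M x m

lemma hitVar_add_hitMean (c : BDChain n) (M x : Fin (n + 1)) :
    c.hitVar M x + c.hitMean M x = 2 * c.hitPot M x - c.hitMean M x ^ 2 := by
  have h : ∑' m : ℕ, (2 * (m : ℝ) + 1) * c.hitSurv M x m
      = 2 * c.hitPot M x - c.hitMean M x := by
    rw [hitPot, hitMean, ← tsum_mul_left,
      ← Summable.tsum_sub ((c.summable_succ_mul_hitSurv M x).mul_left 2) (c.summable_hitSurv M x)]
    exact tsum_congr fun m => by ring
  rw [hitVar, h]; ring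

lemma hitMean_self (c : BDChain n) (M : Fin (n + 1)) : c.hitMean M M = 0 := by
  simp [hitMean, hitSurv_self]

lemma hitPot_self (c : BDChain n) (M : Fin (n + 1)) : c.hitPot M M = 0 := by
  simp [hitPot, hitSurv_self]

lemma hitMean_sub (c : BDChain n) {M x : Fin (n + 1)} (h : x ≠ M) :
    c.hitMean M x - ∑ y, c.K x y * c.hitMean M y = 1 := by
  have h1 : ∑ y, c.K x y * c.hitMean M y = ∑' m, c.hitSurv M x (m + 1) := by
    simp only [hitMean, ← tsum_mul_left]
    rw [← Summable.tsum_finsetSum fun y _ => (c.summable_hitSurv M y).mul_left _]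
    exact tsum_congr fun m => (c.hitSurv_succ h m).symm
  rw [h1, hitMean, (c.summable_hitSurv M x).tsum_eq_zero_add, hitSurv_zero c h]
  ring

lemma hitPot_sub (c : BDChain n) {M x : Fin (n + 1)} (h : x ≠ M) :
    c.hitPot M x - ∑ y, c.K x y * c.hitPot M y = c.hitMean M x := by
  have h1 : ∑ y, c.K x y * c.hitPot M y = ∑' m : ℕ, ((m : ℝ) + 1) * c.hitSurv M x (m + 1) := by
    simp only [hitPot, ← tsum_mul_left]
    rw [← Summable.tsum_finsetSum fun y _ => (c.summable_succ_mul_hitSurv M y).mul_left _]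
    refine tsum_congr fun m => ?_
    rw [c.hitSurv_succ h m, Finset.mul_sum]
    exact Finset.sum_congr rfl fun y _ => by ring
  have h2 : c.hitPot M x - c.hitMean M x = ∑' m : ℕ, (m : ℝ) * c.hitSurv M x m := by
    rw [hitPot, hitMean, ← Summable.tsum_sub (c.summable_succ_mul_hitSurv M x)
      (c.summable_hitSurv M x)]
    exact tsum_congr fun m => by ring
  rw [(c.summable_mul_hitSurv M x).tsum_eq_zero_add] at h2
  push_cast at h2
  rw [h1]
  linarith

lemma eq_sum_range_of_sub_eq (f : Fin (n + 1) → ℝ) (d : ℕ → ℝ) (M : Fin (n + 1)) (hM : f M = 0)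
    (h : ∀ l : ℕ, ∀ hl : l < (M : ℕ), f ⟨l, by omega⟩ - f ⟨l + 1, by omega⟩ = d l) :
    f 0 = ∑ l ∈ Finset.range M, d l := by
  have h1 := Finset.sum_range_sub' (fun k => if hk : k < n + 1 then f ⟨k, hk⟩ else 0) (M : ℕ)
  simp only [Fin.is_lt, dite_true, Fin.eta, hM, sub_zero, Nat.zero_lt_succ] at h1
  rw [show f 0 = f ⟨0, Nat.zero_lt_succ n⟩ from rfl, ← h1]
  refine Finset.sum_congr rfl fun l hl => ?_
  have hl' := Finset.mem_range.mp hl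
  rw [← h l hl', dif_pos (by omega), dif_pos (by omega)]

lemma hitMean_sub_succ (c : BDChain n) (M : Fin (n + 1)) (l : ℕ) (hl : l < M) :
    c.hitMean M ⟨l, by omega⟩ - c.hitMean M ⟨l + 1, by omega⟩ = c.edgeRes l * c.cumMass l := by
  rw [c.sub_eq_edgeRes_mul _ l (by omega), cumMass]
  congr 1
  refine Finset.sum_congr rfl fun k _ => ?_
  split_ifs with hk
  · rw [c.hitMean_sub (by intro h; rw [h] at hk; omega), mul_one]
  · rfl

lemma hitMean_eq_sum (c : BDChain n) (M : Fin (n + 1)) :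
    c.hitMean M 0 = ∑ l ∈ Finset.range M, c.edgeRes l * c.cumMass l :=
  eq_sum_range_of_sub_eq _ _ M (c.hitMean_self M) (c.hitMean_sub_succ M)

lemma sum_pi_mul_hitMean_sub (c : BDChain n) (M : Fin (n + 1)) (l : ℕ) (hl : l < M) :
    (∑ k : Fin (n + 1), if (k : ℕ) ≤ l then
        c.pi k * (c.hitMean M k - c.hitMean M ⟨l + 1, by omega⟩) else 0)
      = ∑ i ∈ Finset.range (l + 1), c.edgeRes i * c.cumMass i ^ 2 := by
  have step : ∀ l : ℕ, ∀ hl : l < (M : ℕ), (∑ k : Fin (n + 1), if (k : ℕ) ≤ l then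
        c.pi k * (c.hitMean M k - c.hitMean M ⟨l + 1, by omega⟩) else 0)
      = (∑ k : Fin (n + 1), if (k : ℕ) < l then
        c.pi k * (c.hitMean M k - c.hitMean M ⟨l, by omega⟩) else 0)
        + c.edgeRes l * c.cumMass l ^ 2 := by
    intro l hl
    have : c.edgeRes l * c.cumMass l ^ 2 = ∑ k : Fin (n + 1), if (k : ℕ) ≤ l then
        c.pi k * (c.hitMean M ⟨l, by omega⟩ - c.hitMean M ⟨l + 1, by omega⟩) else 0 := by
      rw [c.hitMean_sub_succ M l hl, pow_two, ← mul_assoc, mul_comm]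
      nth_rewrite 1 [cumMass]
      rw [Finset.sum_mul]
      exact Finset.sum_congr rfl fun k _ => by split_ifs <;> ring
    rw [this, ← Finset.sum_add_distrib]
    refine Finset.sum_congr rfl fun k _ => ?_
    rcases lt_trichotomy (k : ℕ) l with h | h | h
    · rw [if_pos h.le, if_pos h, if_pos h.le]; ring
    · subst h
      simp
    · rw [if_neg (by omega), if_neg (by omega), if_neg (by omega)]; ring
  induction l with
  | zero => rw [step 0 hl]; simp
  | succ l ih =>
    rw [step (l + 1) hl, Finset.sum_range_succ _ (l + 1), ← ih (by omega) step]
    simp only [Nat.lt_succ_iff]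

lemma hitVar_add_hitMean_eq_varSum (c : BDChain n) (M : Fin (n + 1)) :
    c.hitVar M 0 + c.hitMean M 0 = c.varSum M := by
  rw [hitVar_add_hitMean]
  refine eq_sum_range_of_sub_eq (fun x => 2 * c.hitPot M x - c.hitMean M x ^ 2) _ M
    (by simp [hitPot_self, hitMean_self]) fun l hl => ?_
  have h1 : c.hitPot M ⟨l, by omega⟩ - c.hitPot M ⟨l + 1, by omega⟩ = c.edgeRes l *
      ∑ k : Fin (n + 1), if (k : ℕ) ≤ l then c.pi k * c.hitMean M k else 0 := by
    rw [c.sub_eq_edgeRes_mul _ l (by omega)]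
    congr 1
    refine Finset.sum_congr rfl fun k _ => ?_
    split_ifs with hk
    · rw [c.hitPot_sub (by intro h; rw [h] at hk; omega)]
    · rfl
  have h2 : (∑ k : Fin (n + 1), if (k : ℕ) ≤ l then c.pi k * c.hitMean M k else 0)
      = (∑ i ∈ Finset.range (l + 1), c.edgeRes i * c.cumMass i ^ 2)
        + c.cumMass l * c.hitMean M ⟨l + 1, by omega⟩ := by
    rw [← c.sum_pi_mul_hitMean_sub M l hl, cumMass, Finset.sum_mul, ← Finset.sum_add_distrib]
    exact Finset.sum_congr rfl fun k _ => by split_ifs <;> ring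
  have h3 := c.hitMean_sub_succ M l hl
  rw [h2] at h1
  have h4 : c.hitMean M ⟨l, by omega⟩
    = c.hitMean M ⟨l + 1, by omega⟩ + c.edgeRes l * c.cumMass l := by linarith
  simp only [h4]
  linear_combination 2 * h1

lemma hitVar_le_varSum (c : BDChain n) (M : Fin (n + 1)) : c.hitVar M 0 ≤ c.varSum M := by
  have : 0 ≤ c.hitMean M 0 := tsum_nonneg (c.hitSurv_nonneg M 0)
  linarith [c.hitVar_add_hitMean_eq_varSum M]

/-- Laziness makes the discrete-time variance comparable to the continuous-time one. -/
lemma mul_varSum_le_hitVar (c : BDChain n) {δ : ℝ} (hδ1 : δ ≤ 1) (hδ : ∀ i, δ ≤ c.K i i)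
    (M : Fin (n + 1)) : δ * c.varSum M ≤ c.hitVar M 0 := by
  have h1 : c.hitMean M 0 ≤ (1 - δ) * c.varSum M := by
    refine le_trans ?_ (mul_le_mul_of_nonneg_left (c.sum_sq_le_varSum M) (by linarith))
    rw [hitMean_eq_sum, Finset.mul_sum]
    refine Finset.sum_le_sum fun l hl => ?_
    have hl' := Finset.mem_range.mp hl
    have h := c.one_le_mul_edgeRes_mul_cumMass hδ l (by have := M.isLt; omega)
    have h0 := mul_nonneg (c.edgeRes_nonneg l) (c.cumMass_nonneg l)
    nlinarith [mul_le_mul_of_nonneg_right h h0]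
  linarith [c.hitVar_add_hitMean_eq_varSum M]

lemma hitMean_le_varSum (c : BDChain n) (M : Fin (n + 1)) : c.hitMean M 0 ≤ c.varSum M := by
  have := c.mul_varSum_le_hitVar (δ := 0) zero_le_one (fun i => c.K_nonneg i i) M
  linarith [c.hitVar_add_hitMean_eq_varSum M]

lemma le_hitMean (c : BDChain n) (M : Fin (n + 1)) : ((M : ℕ) : ℝ) ≤ c.hitMean M 0 := by
  rw [hitMean_eq_sum]
  have : ((M : ℕ) : ℝ) = ∑ l ∈ Finset.range (M : ℕ), (1 : ℝ) := by simp
  rw [this]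
  refine Finset.sum_le_sum fun l hl => ?_
  have hl' := Finset.mem_range.mp hl
  have := c.one_le_mul_edgeRes_mul_cumMass (δ := 0) (fun i => c.K_nonneg i i) l
    (by have := M.isLt; omega)
  linarith

lemma abs_hitMean_sub_le (c : BDChain n) (M M' : Fin (n + 1)) {a : ℝ} (ha : 0 < a)
    (hM : a ≤ c.cumMass M) (hM' : a ≤ c.cumMass M') :
    |c.hitMean M 0 - c.hitMean M' 0| ≤ (√(c.varSum M) + √(c.varSum M')) / a := by
  have key : ∀ M M' : Fin (n + 1), M ≤ M' → a ≤ c.cumMass M →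
      |c.hitMean M 0 - c.hitMean M' 0| ≤ √(c.varSum M') / a := by
    intro M M' h hM
    rw [abs_sub_comm, hitMean_eq_sum, hitMean_eq_sum,
      ← Finset.sum_Ico_eq_sub _ (Fin.le_def.mp h), abs_of_nonneg (Finset.sum_nonneg fun l _ =>
        mul_nonneg (c.edgeRes_nonneg l) (c.cumMass_nonneg l)), le_div_iff₀ ha]
    refine Real.le_sqrt_of_sq_le (le_trans ?_ (c.sq_cumMass_mul_le_varSum M M'))
    have h0 : ∀ l, 0 ≤ c.edgeRes l * c.cumMass l := fun l =>
      mul_nonneg (c.edgeRes_nonneg l) (c.cumMass_nonneg l)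
    refine pow_le_pow_left₀ (mul_nonneg (Finset.sum_nonneg fun l _ => h0 l) ha.le) ?_ 2
    rw [mul_comm]
    refine mul_le_mul hM (Finset.sum_le_sum fun l _ => ?_) (Finset.sum_nonneg fun l _ => h0 l)
      (c.cumMass_nonneg _)
    exact mul_le_of_le_one_right (c.edgeRes_nonneg l) (c.cumMass_le_one l)
  rcases le_total M M' with h | h
  · refine (key M M' h hM).trans ?_
    gcongr
    linarith [Real.sqrt_nonneg (c.varSum M)]
  · rw [abs_sub_comm]
    refine (key M' M h hM').trans ?_
    gcongr
    linarith [Real.sqrt_nonneg (c.varSum M')]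

lemma chebyshev_aux {s χ : ℕ → ℝ} (hs : Antitone s) (hs0 : s 0 ≤ 1) (hsn : ∀ m, 0 ≤ s m)
    (hχ : ∀ m, 0 ≤ χ m) (N : ℕ) :
    0 ≤ χ 0 + ∑ m ∈ Finset.range N, s m * (χ (m + 1) - χ m) := by
  suffices h : s N * χ N ≤ χ 0 + ∑ m ∈ Finset.range N, s m * (χ (m + 1) - χ m) from
    (mul_nonneg (hsn N) (hχ N)).trans h
  induction N with
  | zero => simpa using mul_le_of_le_one_left (hχ 0) hs0
  | succ N ih =>
    rw [Finset.sum_range_succ]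
    have := mul_le_mul_of_nonneg_right (hs (Nat.le_succ N)) (hχ (N + 1))
    rw [Nat.succ_eq_add_one] at this
    linarith

lemma hasSum_hitVar (c : BDChain n) (M x : Fin (n + 1)) :
    HasSum (fun m : ℕ => c.hitSurv M x m *
      ((((m + 1 : ℕ) : ℝ) - c.hitMean M x) ^ 2 - ((m : ℝ) - c.hitMean M x) ^ 2))
      (c.hitVar M x - c.hitMean M x ^ 2) := by
  have h1 : Summable fun m : ℕ => (2 * (m : ℝ) + 1) * c.hitSurv M x m := by
    have := ((c.summable_mul_hitSurv M x).mul_left 2).add (c.summable_hitSurv M x)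
    exact this.congr fun m => by ring
  have h2 := h1.hasSum.sub ((c.summable_hitSurv M x).hasSum.mul_left (2 * c.hitMean M x))
  have h3 : c.hitVar M x - c.hitMean M x ^ 2 =
      ∑' m : ℕ, (2 * (m : ℝ) + 1) * c.hitSurv M x m
        - 2 * c.hitMean M x * ∑' m, c.hitSurv M x m := by
    rw [← hitMean, hitVar]; ring
  rw [h3]
  refine h2.congr_fun fun m => ?_
  push_cast; ring

lemma chebyshev_of_le (c : BDChain n) (M x : Fin (n + 1)) (ψ : ℕ → ℝ)
    (hψ : ∀ k, ψ k ≤ ((k : ℝ) - c.hitMean M x) ^ 2) {R : ℝ}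
    (hR : ∀ᶠ N in atTop, ψ 0 + ∑ m ∈ Finset.range N, c.hitSurv M x m * (ψ (m + 1) - ψ m) = R) :
    R ≤ c.hitVar M x := by
  have h1 := ((c.hasSum_hitVar M x).tendsto_sum_nat).const_add (c.hitMean M x ^ 2)
  rw [add_sub_cancel] at h1
  refine ge_of_tendsto h1 (hR.mono fun N hN => ?_)
  have := chebyshev_aux (c.hitSurv_antitone M x) (c.hitSurv_le_one M x 0) (c.hitSurv_nonneg M x)
    (χ := fun k => ((k : ℝ) - c.hitMean M x) ^ 2 - ψ k) (fun k => sub_nonneg.mpr (hψ k)) N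
  have h2 : ∑ m ∈ Finset.range N, c.hitSurv M x m *
      ((((m + 1 : ℕ) : ℝ) - c.hitMean M x) ^ 2 - ψ (m + 1) -
        (((m : ℕ) : ℝ) - c.hitMean M x) ^ 2 + ψ m)
      = (∑ m ∈ Finset.range N, c.hitSurv M x m *
      ((((m + 1 : ℕ) : ℝ) - c.hitMean M x) ^ 2 - ((m : ℝ) - c.hitMean M x) ^ 2))
      - ∑ m ∈ Finset.range N, c.hitSurv M x m * (ψ (m + 1) - ψ m) := by
    rw [← Finset.sum_sub_distrib]
    exact Finset.sum_congr rfl fun m _ => by ring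
  simp only [sub_sub_eq_add_sub, ← sub_add_eq_add_sub] at this
  simp only [sub_add_eq_add_sub] at this h2
  rw [h2] at this
  simp only [Nat.cast_zero, zero_sub, even_two, Even.neg_pow] at this
  linarith

lemma hitSurv_mul_sq_le_hitVar (c : BDChain n) (M x : Fin (n + 1)) {D : ℝ} (hD : 0 ≤ D) (m : ℕ)
    (hm : c.hitMean M x + D ≤ m + 1) : c.hitSurv M x m * D ^ 2 ≤ c.hitVar M x := by
  refine c.chebyshev_of_le M x (fun k => if m < k then D ^ 2 else 0) (fun k => ?_) ?_
  · split_ifs with h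
    · refine pow_le_pow_left₀ hD ?_ 2
      have : ((m + 1 : ℕ) : ℝ) ≤ k := by exact_mod_cast h
      push_cast at this
      linarith
    · positivity
  · filter_upwards [eventually_gt_atTop m] with N hN
    rw [Finset.sum_eq_single_of_mem m (Finset.mem_range.mpr hN)]
    · simp
    · intro k _ hk
      rcases lt_or_gt_of_ne hk with h | h
      · rw [if_neg (by omega), if_neg (by omega)]; simp
      · rw [if_pos (by omega), if_pos (by omega)]; simp

lemma one_sub_hitSurv_mul_sq_le_hitVar (c : BDChain n) (M x : Fin (n + 1)) {D : ℝ} (hD : 0 ≤ D)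
    (m : ℕ) (hm : m + D ≤ c.hitMean M x) : (1 - c.hitSurv M x m) * D ^ 2 ≤ c.hitVar M x := by
  refine c.chebyshev_of_le M x (fun k => if k ≤ m then D ^ 2 else 0) (fun k => ?_) ?_
  · split_ifs with h
    · rw [← neg_sub, neg_sq]
      refine pow_le_pow_left₀ hD ?_ 2
      have : (k : ℝ) ≤ m := by exact_mod_cast h
      linarith
    · positivity
  · filter_upwards [eventually_gt_atTop m] with N hN
    rw [Finset.sum_eq_single_of_mem m (Finset.mem_range.mpr hN)]
    · simp; ring
    · intro k _ hk
      rcases lt_or_gt_of_ne hk with h | h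
      · rw [if_pos (by omega), if_pos (by omega)]; simp
      · rw [if_neg (by omega), if_neg (by omega)]; simp

/-! ### Smoothing estimates in `L²(π)` -/

/-- The inner product of `L²(π)`. -/
def ip (c : BDChain n) (f g : Fin (n + 1) → ℝ) : ℝ := ∑ x, c.pi x * f x * g x

lemma ip_comm (c : BDChain n) (f g : Fin (n + 1) → ℝ) : c.ip f g = c.ip g f :=
  Finset.sum_congr rfl fun x _ => by ring

lemma ip_add_left (c : BDChain n) (f g h : Fin (n + 1) → ℝ) :
    c.ip (f + g) h = c.ip f h + c.ip g h := by
  rw [ip, ip, ip, ← Finset.sum_add_distrib]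
  exact Finset.sum_congr rfl fun x _ => by simp only [Pi.add_apply]; ring

lemma ip_smul_left (c : BDChain n) (a : ℝ) (f h : Fin (n + 1) → ℝ) :
    c.ip (a • f) h = a * c.ip f h := by
  rw [ip, ip, Finset.mul_sum]
  exact Finset.sum_congr rfl fun x _ => by simp only [Pi.smul_apply, smul_eq_mul]; ring

lemma ip_sub_left (c : BDChain n) (f g h : Fin (n + 1) → ℝ) :
    c.ip (f - g) h = c.ip f h - c.ip g h := by
  rw [ip, ip, ip, ← Finset.sum_sub_distrib]
  exact Finset.sum_congr rfl fun x _ => by simp only [Pi.sub_apply]; ring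

lemma ip_add_right (c : BDChain n) (f g h : Fin (n + 1) → ℝ) :
    c.ip h (f + g) = c.ip h f + c.ip h g := by
  simp only [c.ip_comm h, ip_add_left]

lemma ip_sub_right (c : BDChain n) (f g h : Fin (n + 1) → ℝ) :
    c.ip h (f - g) = c.ip h f - c.ip h g := by
  simp only [c.ip_comm h, ip_sub_left]

lemma ip_smul_right (c : BDChain n) (a : ℝ) (f h : Fin (n + 1) → ℝ) :
    c.ip h (a • f) = a * c.ip h f := by
  simp only [c.ip_comm h, ip_smul_left]

lemma ip_self_nonneg (c : BDChain n) (f : Fin (n + 1) → ℝ) : 0 ≤ c.ip f f :=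
  Finset.sum_nonneg fun x _ => by
    rw [mul_assoc]; exact mul_nonneg (c.pi_pos x).le (mul_self_nonneg _)

lemma ip_K_left (c : BDChain n) (f g : Fin (n + 1) → ℝ) :
    c.ip (c.K *ᵥ f) g = c.ip f (c.K *ᵥ g) := by
  simp only [ip, Matrix.mulVec, dotProduct, Finset.mul_sum, Finset.sum_mul]
  rw [Finset.sum_comm]
  refine Finset.sum_congr rfl fun x _ => Finset.sum_congr rfl fun y _ => ?_
  linear_combination (f x * g y) * c.detailed_balance y x

lemma ip_lazy_contraction (c : BDChain n) {δ : ℝ} (hδ : ∀ i, δ ≤ c.K i i)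
    (f : Fin (n + 1) → ℝ) :
    c.ip (c.K *ᵥ f - δ • f) (c.K *ᵥ f - δ • f) ≤ (1 - δ) ^ 2 * c.ip f f := by
  set P : Fin (n + 1) → Fin (n + 1) → ℝ := fun x y => c.K x y - if x = y then δ else 0 with hP
  have hP0 : ∀ x y, 0 ≤ P x y := by
    intro x y
    simp only [hP]
    split_ifs with h
    · subst h; linarith [hδ x]
    · simpa using c.K_nonneg x y
  have hrow : ∀ x, ∑ y, P x y = 1 - δ := by
    intro x; simp [hP, Finset.sum_sub_distrib, c.K_rowSum]
  have hcol : ∀ y, ∑ x, c.pi x * P x y = (1 - δ) * c.pi y := by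
    intro y
    simp only [hP, mul_sub, Finset.sum_sub_distrib, c.pi_stat]
    simp; ring
  have happ : ∀ x, (c.K *ᵥ f - δ • f) x = ∑ y, P x y * f y := by
    intro x
    simp [hP, Matrix.mulVec, dotProduct, sub_mul, Finset.sum_sub_distrib]
  have hcs : ∀ x, (∑ y, P x y * f y) ^ 2 ≤ (1 - δ) * ∑ y, P x y * f y ^ 2 := by
    intro x
    rw [← hrow x]
    refine Finset.sum_sq_le_sum_mul_sum_of_sq_le_mul _ (fun y _ => hP0 x y)
      (fun y _ => mul_nonneg (hP0 x y) (sq_nonneg _)) fun y _ => (by ring : _ = _).le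
  calc c.ip (c.K *ᵥ f - δ • f) (c.K *ᵥ f - δ • f)
      = ∑ x, c.pi x * (∑ y, P x y * f y) ^ 2 :=
        Finset.sum_congr rfl fun x _ => by rw [happ]; ring
    _ ≤ ∑ x, c.pi x * ((1 - δ) * ∑ y, P x y * f y ^ 2) :=
        Finset.sum_le_sum fun x _ => mul_le_mul_of_nonneg_left (hcs x) (c.pi_pos x).le
    _ = (1 - δ) * ∑ y, (∑ x, c.pi x * P x y) * f y ^ 2 := by
        simp only [Finset.mul_sum, Finset.sum_mul]
        rw [Finset.sum_comm]
        exact Finset.sum_congr rfl fun x _ => Finset.sum_congr rfl fun y _ => by ring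
    _ = (1 - δ) ^ 2 * c.ip f f := by
        simp only [hcol, ip, Finset.mul_sum]
        exact Finset.sum_congr rfl fun x _ => by ring

lemma ip_K_K_le (c : BDChain n) (f : Fin (n + 1) → ℝ) :
    c.ip (c.K *ᵥ f) (c.K *ᵥ f) ≤ c.ip f f := by
  simpa using c.ip_lazy_contraction (δ := 0) (fun i => c.K_nonneg i i) f

/-- The Dirichlet form of the chain. -/
def energy (c : BDChain n) (f : Fin (n + 1) → ℝ) : ℝ := c.ip f f - c.ip f (c.K *ᵥ f)

lemma energy_nonneg (c : BDChain n) (f : Fin (n + 1) → ℝ) : 0 ≤ c.energy f := by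
  have h1 := c.ip_self_nonneg (f - c.K *ᵥ f)
  have h2 := c.ip_K_K_le f
  simp only [ip_sub_left, ip_sub_right, c.ip_comm (c.K *ᵥ f) f] at h1
  rw [energy]; linarith

lemma ip_K_le_sub_energy (c : BDChain n) {δ : ℝ} (hδ : ∀ i, δ ≤ c.K i i)
    (f : Fin (n + 1) → ℝ) :
    c.ip (c.K *ᵥ f) (c.K *ᵥ f) ≤ c.ip f f - 2 * δ * c.energy f := by
  have h := c.ip_lazy_contraction hδ f
  simp only [ip_sub_left, ip_sub_right, ip_smul_left, ip_smul_right,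
    c.ip_comm (c.K *ᵥ f) f] at h
  rw [energy]; nlinarith

lemma energy_K_le (c : BDChain n) {δ : ℝ} (hδ1 : δ < 1) (hδ : ∀ i, δ ≤ c.K i i)
    (f : Fin (n + 1) → ℝ) :
    c.energy (c.K *ᵥ f) ≤ c.energy f - 2 * δ * c.ip (f - c.K *ᵥ f) (f - c.K *ᵥ f) := by
  have key : ∀ h : Fin (n + 1) → ℝ, 2 * δ * c.ip h h ≤ c.ip h h + c.ip h (c.K *ᵥ h) := by
    intro h
    have h1 := c.ip_lazy_contraction hδ h
    have h2 := c.ip_self_nonneg ((c.K *ᵥ h - δ • h) + (1 - δ) • h)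
    rw [ip_add_left, ip_add_right, ip_add_right] at h2
    simp only [ip_smul_left, ip_smul_right, c.ip_comm (c.K *ᵥ h - δ • h) h] at h2
    have h3 : c.ip h (c.K *ᵥ h - δ • h) = c.ip h (c.K *ᵥ h) - δ * c.ip h h := by
      rw [ip_sub_right, ip_smul_right]
    rw [h3] at h2
    have h4 : 0 ≤ (2 * (1 - δ)) *
        ((1 - δ) * c.ip h h + (c.ip h (c.K *ᵥ h) - δ * c.ip h h)) := by nlinarith
    have := nonneg_of_mul_nonneg_right h4 (by linarith)
    linarith
  have h := key (f - c.K *ᵥ f)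
  have e : c.ip f (c.K *ᵥ (c.K *ᵥ f)) = c.ip (c.K *ᵥ f) (c.K *ᵥ f) := (c.ip_K_left f _).symm
  rw [energy, energy]
  simp only [Matrix.mulVec_sub, ip_sub_left, ip_sub_right, c.ip_comm (c.K *ᵥ f) f, e] at h ⊢
  linarith

/-- Analyticity of a lazy reversible semigroup: `‖(I - K) K ^ r g‖ = O(‖g‖ / r)`. -/
lemma ip_sub_K_pow_le (c : BDChain n) {δ : ℝ} (hδ0 : 0 ≤ δ) (hδ1 : δ < 1)
    (hδ : ∀ i, δ ≤ c.K i i) (g : Fin (n + 1) → ℝ) (r : ℕ) :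
    (δ * r) ^ 2 * c.ip ((c.K ^ r) *ᵥ g - c.K *ᵥ ((c.K ^ r) *ᵥ g))
      ((c.K ^ r) *ᵥ g - c.K *ᵥ ((c.K ^ r) *ᵥ g)) ≤ c.ip g g := by
  have key : c.ip ((c.K ^ r) *ᵥ g) ((c.K ^ r) *ᵥ g) + 2 * δ * r * c.energy ((c.K ^ r) *ᵥ g)
      + 2 * δ ^ 2 * (r * (r + 1)) * c.ip ((c.K ^ r) *ᵥ g - c.K *ᵥ ((c.K ^ r) *ᵥ g))
      ((c.K ^ r) *ᵥ g - c.K *ᵥ ((c.K ^ r) *ᵥ g)) ≤ c.ip g g := by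
    induction r with
    | zero => simp
    | succ r ih =>
      refine le_trans ?_ ih
      have e : (c.K ^ (r + 1)) *ᵥ g = c.K *ᵥ ((c.K ^ r) *ᵥ g) := by
        rw [pow_succ', Matrix.mulVec_mulVec]
      rw [e]
      set f := (c.K ^ r) *ᵥ g
      have h1 := c.ip_K_le_sub_energy hδ f
      have h2 := c.energy_K_le hδ1 hδ f
      have h3 := c.ip_K_K_le (f - c.K *ᵥ f)
      rw [Matrix.mulVec_sub] at h3
      set a := c.ip (f - c.K *ᵥ f) (f - c.K *ᵥ f)
      push_cast
      have hr : (0 : ℝ) ≤ r := r.cast_nonneg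
      have h2' := mul_le_mul_of_nonneg_left h2 (show 0 ≤ 2 * δ * (r + 1) by positivity)
      have h3' := mul_le_mul_of_nonneg_left h3
        (show 0 ≤ 2 * δ ^ 2 * ((r + 1) * (r + 1 + 1 : ℝ)) by positivity)
      nlinarith
  have h1 := c.ip_self_nonneg ((c.K ^ r) *ᵥ g)
  have h2 := mul_nonneg (show 0 ≤ 2 * δ * r by positivity) (c.energy_nonneg ((c.K ^ r) *ᵥ g))
  have h3 := mul_nonneg (show 0 ≤ δ ^ 2 * (r ^ 2 + 2 * r : ℝ) by positivity)
    (c.ip_self_nonneg ((c.K ^ r) *ᵥ g - c.K *ᵥ ((c.K ^ r) *ᵥ g)))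
  nlinarith

lemma K_pow_nonneg (c : BDChain n) (m : ℕ) (x y : Fin (n + 1)) : 0 ≤ (c.K ^ m) x y := by
  induction m generalizing x with
  | zero => rw [pow_zero, Matrix.one_apply]; split_ifs <;> norm_num
  | succ m ih =>
    rw [pow_succ', Matrix.mul_apply]
    exact Finset.sum_nonneg fun z _ => mul_nonneg (c.K_nonneg x z) (ih z)

lemma K_pow_rowSum (c : BDChain n) (m : ℕ) (x : Fin (n + 1)) : ∑ y, (c.K ^ m) x y = 1 := by
  induction m generalizing x with
  | zero => simp [Matrix.one_apply]
  | succ m ih =>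
    simp only [pow_succ', Matrix.mul_apply]
    rw [Finset.sum_comm]
    simp only [← Finset.mul_sum, ih, mul_one, c.K_rowSum]

lemma sum_K_pow_nonneg (c : BDChain n) (m : ℕ) (x : Fin (n + 1)) (A : Finset (Fin (n + 1))) :
    0 ≤ ∑ y ∈ A, (c.K ^ m) x y := Finset.sum_nonneg fun y _ => c.K_pow_nonneg m x y

lemma sum_K_pow_le_one (c : BDChain n) (m : ℕ) (x : Fin (n + 1)) (A : Finset (Fin (n + 1))) :
    ∑ y ∈ A, (c.K ^ m) x y ≤ 1 := by
  rw [← c.K_pow_rowSum m x]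
  exact Finset.sum_le_sum_of_subset_of_nonneg (Finset.subset_univ A)
    fun y _ _ => c.K_pow_nonneg m x y

lemma sum_pi_nonneg (c : BDChain n) (A : Finset (Fin (n + 1))) : 0 ≤ ∑ y ∈ A, c.pi y :=
  Finset.sum_nonneg fun y _ => (c.pi_pos y).le

lemma sum_pi_le_one (c : BDChain n) (A : Finset (Fin (n + 1))) : ∑ y ∈ A, c.pi y ≤ 1 := by
  rw [← c.pi_sum]
  exact Finset.sum_le_sum_of_subset_of_nonneg (Finset.subset_univ A) fun y _ _ => (c.pi_pos y).le

/-- The deviation `K ^ m (x, A) - π(A)`. -/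
def dev (c : BDChain n) (A : Finset (Fin (n + 1))) (m : ℕ) (x : Fin (n + 1)) : ℝ :=
  ∑ y ∈ A, (c.K ^ m) x y - ∑ y ∈ A, c.pi y

lemma dev_succ (c : BDChain n) (A : Finset (Fin (n + 1))) (m : ℕ) (x : Fin (n + 1)) :
    c.dev A (m + 1) x = ∑ y, c.K x y * c.dev A m y := by
  have h : ∑ y ∈ A, (c.K ^ (m + 1)) x y = ∑ z, c.K x z * ∑ y ∈ A, (c.K ^ m) z y := by
    simp only [pow_succ', Matrix.mul_apply, Finset.mul_sum]
    rw [Finset.sum_comm]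
  simp only [dev, mul_sub, Finset.sum_sub_distrib]
  rw [h, ← Finset.sum_mul, c.K_rowSum, one_mul]

lemma dev_eq_mulVec (c : BDChain n) (A : Finset (Fin (n + 1))) (m : ℕ) :
    c.dev A m = (c.K ^ m) *ᵥ c.dev A 0 := by
  induction m with
  | zero => simp
  | succ m ih =>
    rw [pow_succ', ← Matrix.mulVec_mulVec, ← ih]
    ext x
    rw [dev_succ, Matrix.mulVec, dotProduct]

lemma dev_le_one (c : BDChain n) (A : Finset (Fin (n + 1))) (m : ℕ) (x : Fin (n + 1)) :
    c.dev A m x ≤ 1 := by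
  rw [dev]; linarith [c.sum_K_pow_le_one m x A, c.sum_pi_nonneg A]

lemma neg_one_le_dev (c : BDChain n) (A : Finset (Fin (n + 1))) (m : ℕ) (x : Fin (n + 1)) :
    -1 ≤ c.dev A m x := by
  rw [dev]; linarith [c.sum_K_pow_nonneg m x A, c.sum_pi_le_one A]

lemma abs_dev_sub_le_one (c : BDChain n) (A : Finset (Fin (n + 1))) (m : ℕ)
    (x y : Fin (n + 1)) : |c.dev A m x - c.dev A m y| ≤ 1 := by
  rw [dev, dev, abs_le]
  constructor <;> linarith [c.sum_K_pow_nonneg m x A, c.sum_K_pow_nonneg m y A,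
    c.sum_K_pow_le_one m x A, c.sum_K_pow_le_one m y A]

lemma sum_pi_mul_dev (c : BDChain n) (A : Finset (Fin (n + 1))) (m : ℕ) :
    ∑ x, c.pi x * c.dev A m x = 0 := by
  induction m with
  | zero =>
    have h : ∑ x, c.pi x * ∑ y ∈ A, (c.K ^ 0) x y = ∑ y ∈ A, c.pi y := by
      simp only [Finset.mul_sum]
      rw [Finset.sum_comm]
      simp [Matrix.one_apply]
    simp only [dev, mul_sub, Finset.sum_sub_distrib]
    rw [h, ← Finset.sum_mul, c.pi_sum, one_mul, sub_self]
  | succ m ih =>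
    rw [← ih]
    simp only [dev_succ, Finset.mul_sum]
    rw [Finset.sum_comm]
    refine Finset.sum_congr rfl fun y _ => ?_
    rw [← c.pi_stat y, Finset.sum_mul]
    exact Finset.sum_congr rfl fun x _ => by ring

lemma ip_dev_le_one (c : BDChain n) (A : Finset (Fin (n + 1))) (m : ℕ) :
    c.ip (c.dev A m) (c.dev A m) ≤ 1 := by
  rw [← c.pi_sum]
  refine Finset.sum_le_sum fun x _ => ?_
  have h1 := c.dev_le_one A m x
  have h2 := c.neg_one_le_dev A m x
  rw [mul_assoc]
  exact mul_le_of_le_one_right (c.pi_pos x).le (by nlinarith)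

/-- After `r` steps, `K ^ r (·, A)` is almost constant across an edge of small resistance. -/
lemma mul_abs_dev_sub_succ_le (c : BDChain n) {δ : ℝ} (hδ0 : 0 ≤ δ) (hδ1 : δ < 1)
    (hδ : ∀ i, δ ≤ c.K i i) (A : Finset (Fin (n + 1))) (r l : ℕ) (hl : l < n) :
    δ * r * |c.dev A r ⟨l, by omega⟩ - c.dev A r ⟨l + 1, by omega⟩| ≤ c.edgeRes l := by
  set ψ := c.dev A r - c.K *ᵥ c.dev A r with hψ
  have h1 : (δ * r) ^ 2 * c.ip ψ ψ ≤ 1 := by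
    have := c.ip_sub_K_pow_le hδ0 hδ1 hδ (c.dev A 0) r
    rw [← dev_eq_mulVec] at this
    exact this.trans (c.ip_dev_le_one A 0)
  have h2 := c.sub_eq_edgeRes_mul (c.dev A r) l hl
  set Φ := ∑ k : Fin (n + 1), if (k : ℕ) ≤ l then
    c.pi k * (c.dev A r k - ∑ y, c.K k y * c.dev A r y) else 0
  have h3 : Φ ^ 2 ≤ 1 * c.ip ψ ψ := by
    rw [← c.pi_sum]
    refine Finset.sum_sq_le_sum_mul_sum_of_sq_le_mul _ (fun k _ => (c.pi_pos k).le)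
      (fun k _ => by rw [mul_assoc]; exact mul_nonneg (c.pi_pos k).le (mul_self_nonneg _))
      fun k _ => ?_
    have : ψ k = c.dev A r k - ∑ y, c.K k y * c.dev A r y := rfl
    rw [← this]
    split_ifs
    · exact (by ring : _ = _).le
    · rw [mul_assoc, zero_pow two_ne_zero]
      exact mul_nonneg (c.pi_pos k).le (mul_nonneg (c.pi_pos k).le (mul_self_nonneg _))
  have h4 : (δ * r * |Φ|) ^ 2 ≤ 1 := by
    rw [mul_pow, sq_abs]
    nlinarith [sq_nonneg (δ * r)]
  have h5 : δ * r * |Φ| ≤ 1 := by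
    have := abs_le_of_sq_le_sq' (h4.trans (one_pow 2).symm.le) zero_le_one
    exact this.2
  rw [h2, abs_mul, abs_of_nonneg (c.edgeRes_nonneg l)]
  nlinarith [c.edgeRes_nonneg l]

lemma mul_abs_dev_sub_le (c : BDChain n) {δ : ℝ} (hδ0 : 0 ≤ δ) (hδ1 : δ < 1)
    (hδ : ∀ i, δ ≤ c.K i i) (A : Finset (Fin (n + 1))) (r : ℕ) (M : Fin (n + 1)) (k : ℕ)
    (hk : k ≤ M) :
    δ * r * |c.dev A r ⟨k, by omega⟩ - c.dev A r M| ≤ ∑ l ∈ Finset.Ico k M, c.edgeRes l := by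
  induction hk using Nat.decreasingInduction with
  | self => simp
  | of_succ k hk ih =>
    rw [Finset.sum_eq_sum_Ico_succ_bot hk]
    have h1 := c.mul_abs_dev_sub_succ_le hδ0 hδ1 hδ A r k (by omega)
    have h2 := abs_sub_le (c.dev A r ⟨k, by omega⟩) (c.dev A r ⟨k + 1, by omega⟩) (c.dev A r M)
    have h3 := mul_le_mul_of_nonneg_left h2 (mul_nonneg hδ0 (Nat.cast_nonneg r))
    linarith

lemma dev_le_of_lazy (c : BDChain n) {δ : ℝ} (hδ0 : 0 < δ) (hδ1 : δ < 1)
    (hδ : ∀ i, δ ≤ c.K i i) (A : Finset (Fin (n + 1))) {r : ℕ} (hr : 0 < r)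
    (j M : Fin (n + 1)) {η a : ℝ} (hj : 1 - η ≤ c.piHigh j) (hM : 1 - η ≤ c.piLow M)
    (ha : 0 < a) (hja : a ≤ c.piLow j) :
    c.dev A r M ≤ 2 * η + √(c.varSum M) / (a * (δ * r)) := by
  have hr' : (0 : ℝ) < r := by exact_mod_cast hr
  set S := √(c.varSum M) / (a * (δ * r)) with hS
  have hS0 : 0 ≤ S := by positivity
  have hosc : (∑ l ∈ Finset.Ico (j : ℕ) M, c.edgeRes l) ≤ √(c.varSum M) / a := by
    rw [le_div_iff₀ ha]
    refine Real.le_sqrt_of_sq_le (le_trans ?_ (c.sq_cumMass_mul_le_varSum j M))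
    have h0 : 0 ≤ ∑ l ∈ Finset.Ico (j : ℕ) M, c.edgeRes l :=
      Finset.sum_nonneg fun l _ => c.edgeRes_nonneg l
    rw [mul_comm]
    exact pow_le_pow_left₀ (by positivity) (mul_le_mul_of_nonneg_right hja h0) 2
  have hmid : ∀ x : Fin (n + 1), j ≤ x → x ≤ M → |c.dev A r x - c.dev A r M| ≤ S := by
    intro x hjx hxM
    have h1 := c.mul_abs_dev_sub_le hδ0.le hδ1 hδ A r M x hxM
    have h2 : (∑ l ∈ Finset.Ico (x : ℕ) M, c.edgeRes l)
        ≤ ∑ l ∈ Finset.Ico (j : ℕ) M, c.edgeRes l :=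
      Finset.sum_le_sum_of_subset_of_nonneg (Finset.Ico_subset_Ico_left hjx)
        fun l _ _ => c.edgeRes_nonneg l
    rw [hS, ← div_div, le_div_iff₀ (by positivity), mul_comm]
    exact h1.trans (h2.trans hosc)
  have hterm : ∀ x : Fin (n + 1), c.pi x * (c.dev A r M - c.dev A r x) ≤
      (c.pi x - (if j ≤ x then c.pi x else 0)) + (c.pi x - (if x ≤ M then c.pi x else 0))
        + c.pi x * S := by
    intro x
    have hp := c.pi_pos x
    have h1 := (abs_le.mp (c.abs_dev_sub_le_one A r M x)).2
    by_cases hjx : j ≤ x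
    · by_cases hxM : x ≤ M
      · rw [if_pos hjx, if_pos hxM]
        have h2 := (abs_le.mp (hmid x hjx hxM)).1
        nlinarith
      · rw [if_pos hjx, if_neg hxM]
        nlinarith [mul_nonneg hp.le hS0]
    · have : (0 : ℝ) ≤ c.pi x - (if x ≤ M then c.pi x else 0) := by split_ifs <;> linarith
      rw [if_neg hjx]
      nlinarith [mul_nonneg hp.le hS0]
  have hsum := Finset.sum_le_sum fun x (_ : x ∈ Finset.univ) => hterm x
  simp only [mul_sub, Finset.sum_sub_distrib, Finset.sum_add_distrib, ← Finset.sum_mul, c.pi_sum,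
    c.sum_pi_mul_dev] at hsum
  rw [← piHigh, ← piLow] at hsum
  linarith

lemma dev_add_le (c : BDChain n) (A : Finset (Fin (n + 1))) (M : Fin (n + 1)) {r : ℕ} {S : ℝ}
    (hS0 : 0 ≤ S) (hS : ∀ s, r ≤ s → c.dev A s M ≤ S) (m : ℕ) (x : Fin (n + 1)) :
    c.dev A (m + r) x ≤ S + c.hitSurv M x m := by
  induction m generalizing x with
  | zero =>
    by_cases h : x = M
    · rw [h, hitSurv_self, add_zero]; exact hS _ (by omega)
    · rw [hitSurv_zero c h]; linarith [c.dev_le_one A (0 + r) x]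
  | succ m ih =>
    by_cases h : x = M
    · rw [h, hitSurv_self, add_zero]; exact hS _ (by omega)
    · rw [add_right_comm, dev_succ, hitSurv_succ c h]
      refine (c.sum_K_mul_le x fun y _ => ih y).trans (le_of_eq ?_)
      simp only [mul_add, Finset.sum_add_distrib, ← Finset.sum_mul, c.K_rowSum, one_mul]

lemma hitSurv_le_sum_K_pow (c : BDChain n) (M : Fin (n + 1)) (m : ℕ) (x : Fin (n + 1))
    (hx : x ≤ M) : c.hitSurv M x m ≤ ∑ y with y < M, (c.K ^ m) x y := by
  induction m generalizing x with
  | zero =>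
    by_cases h : x = M
    · rw [h, hitSurv_self]; exact c.sum_K_pow_nonneg _ _ _
    · rw [hitSurv_zero c h]
      have : x < M := lt_of_le_of_ne hx h
      simp [Matrix.one_apply, this]
  | succ m ih =>
    by_cases h : x = M
    · rw [h, hitSurv_self]; exact c.sum_K_pow_nonneg _ _ _
    · have hlt : x < M := lt_of_le_of_ne hx h
      simp only [pow_succ', Matrix.mul_apply]
      rw [hitSurv_succ c h, Finset.sum_comm]
      simp only [← Finset.mul_sum]
      refine c.sum_K_mul_le x fun y hy => ih y ?_
      by_contra hyM
      refine hy (c.K_tridiag x y ?_)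
      rw [lt_abs]
      have := Fin.lt_def.mp hlt
      have := Fin.lt_def.mp (not_le.mp hyM)
      omega

lemma sum_pi_lt (c : BDChain n) (M : Fin (n + 1)) :
    ∑ y with y < M, c.pi y = 1 - c.piHigh M := by
  rw [← c.pi_sum, piHigh, ← Finset.sum_sub_distrib, Finset.sum_filter]
  refine Finset.sum_congr rfl fun y _ => ?_
  by_cases h : y < M
  · rw [if_pos h, if_neg (not_le.mpr h)]; ring
  · rw [if_neg h, if_pos (not_lt.mp h)]; ring

/-- Upper bound on the deviation from equilibrium after the hitting time of `M`. -/
lemma dev_le_of_hitMean_add_le (c : BDChain n) {δ : ℝ} (hδ0 : 0 < δ) (hδ1 : δ < 1)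
    (hδ : ∀ i, δ ≤ c.K i i) (A : Finset (Fin (n + 1))) {r : ℕ} (hr : 0 < r)
    (j M : Fin (n + 1)) {η a : ℝ} (hη : 0 ≤ η) (hj : 1 - η ≤ c.piHigh j)
    (hM : 1 - η ≤ c.piLow M) (ha : 0 < a) (hja : a ≤ c.piLow j) {D : ℝ} (hD : 0 < D) {m : ℕ}
    (hm : c.hitMean M 0 + D + r ≤ m) :
    c.dev A m 0 ≤ 2 * η + √(c.varSum M) / (a * (δ * r)) + c.varSum M / D ^ 2 := by
  have hu : 0 ≤ c.hitMean M 0 := tsum_nonneg (c.hitSurv_nonneg M 0)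
  have hr' : (0 : ℝ) < r := by exact_mod_cast hr
  have hrm : r ≤ m := by
    have : (r : ℝ) ≤ m := by linarith
    exact_mod_cast this
  obtain ⟨k, rfl⟩ := Nat.exists_eq_add_of_le' hrm
  push_cast at hm
  refine (c.dev_add_le A M (by positivity) (fun s hs => ?_) k 0).trans
    (add_le_add le_rfl ?_)
  · refine (c.dev_le_of_lazy hδ0 hδ1 hδ A (hr.trans_le hs) j M hj hM ha hja).trans ?_
    have : (r : ℝ) ≤ s := by exact_mod_cast hs
    gcongr
  · rw [le_div_iff₀ (by positivity)]
    exact (c.hitSurv_mul_sq_le_hitVar M 0 hD.le k (by linarith)).trans (c.hitVar_le_varSum M)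

/-- Lower bound on the deviation from equilibrium before the hitting time of `M`. -/
lemma le_dev_of_add_le_hitMean (c : BDChain n) (M : Fin (n + 1)) {D : ℝ} (hD : 0 < D) {m : ℕ}
    (hm : m + D ≤ c.hitMean M 0) :
    c.piHigh M - c.varSum M / D ^ 2 ≤ c.dev {y | y < M} m 0 := by
  have h1 := (c.one_sub_hitSurv_mul_sq_le_hitVar M 0 hD.le m hm).trans (c.hitVar_le_varSum M)
  rw [← le_div_iff₀ (by positivity)] at h1
  have h2 := c.hitSurv_le_sum_K_pow M m 0 (Fin.zero_le M)
  rw [dev, sum_pi_lt]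
  linarith

/-! ### Poisson averages -/

/-- The weight of `m` under the Poisson distribution of mean `s`. -/
def poissonWeight (s : ℝ) (m : ℕ) : ℝ := Real.exp (-s) * s ^ m / m.factorial

lemma poissonWeight_nonneg {s : ℝ} (hs : 0 ≤ s) (m : ℕ) : 0 ≤ poissonWeight s m := by
  unfold poissonWeight; positivity

lemma succ_mul_poissonWeight_succ (s : ℝ) (m : ℕ) :
    ((m : ℝ) + 1) * poissonWeight s (m + 1) = s * poissonWeight s m := by
  simp only [poissonWeight, Nat.factorial_succ, pow_succ]
  push_cast
  have : (m.factorial : ℝ) ≠ 0 := by positivity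
  field_simp

lemma hasSum_poissonWeight (s : ℝ) : HasSum (poissonWeight s) 1 := by
  have h := (NormedSpace.expSeries_div_hasSum_exp s).mul_left (Real.exp (-s))
  rw [← Real.exp_eq_exp_ℝ, ← Real.exp_add, neg_add_cancel, Real.exp_zero] at h
  exact h.congr_fun fun m => mul_div_assoc _ _ _

lemma hasSum_mul_poissonWeight (s : ℝ) : HasSum (fun m : ℕ => (m : ℝ) * poissonWeight s m) s := by
  have h := (hasSum_poissonWeight s).mul_left s
  rw [← hasSum_nat_add_iff' 1]
  simpa [succ_mul_poissonWeight_succ] using h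

lemma hasSum_poissonWeight_mul_sq (s : ℝ) :
    HasSum (fun m : ℕ => poissonWeight s m * ((m : ℝ) - s) ^ 2) s := by
  have h1 : HasSum (fun m : ℕ => (m : ℝ) ^ 2 * poissonWeight s m) (s * s + s) := by
    have h := ((hasSum_mul_poissonWeight s).add (hasSum_poissonWeight s)).mul_left s
    rw [← hasSum_nat_add_iff' 1]
    have e : ∀ m : ℕ, ((m : ℝ) + 1) ^ 2 * poissonWeight s (m + 1)
        = s * (m * poissonWeight s m + poissonWeight s m) := by
      intro m
      rw [pow_two, mul_assoc, succ_mul_poissonWeight_succ]; ring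
    simpa [e, mul_add] using h
  have h := (h1.sub ((hasSum_mul_poissonWeight s).mul_left (2 * s))).add
    ((hasSum_poissonWeight s).mul_left (s ^ 2))
  have e : s * s + s - 2 * s * s + s ^ 2 * 1 = s := by ring
  rw [e] at h
  exact h.congr_fun fun m => by ring

lemma summable_poissonWeight_mul {s : ℝ} (hs : 0 ≤ s) {d : ℕ → ℝ} (hd : ∀ m, |d m| ≤ 1) :
    Summable fun m => poissonWeight s m * d m := by
  refine Summable.of_norm_bounded (hasSum_poissonWeight s).summable fun m => ?_
  rw [Real.norm_eq_abs, abs_mul, abs_of_nonneg (poissonWeight_nonneg hs m)]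
  exact mul_le_of_le_one_right (poissonWeight_nonneg hs m) (hd m)

/-- Chebyshev's inequality for Poisson averages. -/
lemma tsum_poissonWeight_mul_le {s : ℝ} (hs : 0 ≤ s) {d : ℕ → ℝ} (hd : ∀ m, |d m| ≤ 1)
    {β E : ℝ} (hE : 0 < E) (h1 : ∀ m, d m ≤ β + 1)
    (h2 : ∀ m : ℕ, d m ≤ β ∨ E ^ 2 ≤ ((m : ℝ) - s) ^ 2) :
    ∑' m, poissonWeight s m * d m ≤ β + s / E ^ 2 := by
  have h := ((hasSum_poissonWeight s).mul_right β).add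
    ((hasSum_poissonWeight_mul_sq s).mul_right (E ^ 2)⁻¹)
  rw [one_mul, ← div_eq_mul_inv] at h
  refine hasSum_le (fun m => ?_) (summable_poissonWeight_mul hs hd).hasSum h
  rw [mul_assoc, ← mul_add, ← div_eq_mul_inv]
  refine mul_le_mul_of_nonneg_left ?_ (poissonWeight_nonneg hs m)
  rcases h2 m with h2 | h2
  · linarith [show 0 ≤ ((m : ℝ) - s) ^ 2 / E ^ 2 by positivity]
  · rw [← one_le_div (by positivity)] at h2
    linarith [h1 m]

lemma integrableOn_pow_mul_poissonWeight (k m : ℕ) :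
    IntegrableOn (fun t => t ^ k * poissonWeight t m) (Set.Ioi 0) := by
  have h := (Real.GammaIntegral_convergent (s := (k + m : ℕ) + 1) (by positivity)).const_mul
    ((m.factorial : ℝ)⁻¹)
  refine h.congr ?_
  filter_upwards [ae_restrict_mem measurableSet_Ioi] with t ht
  rw [add_sub_cancel_right, Real.rpow_natCast, poissonWeight, pow_add]
  ring

lemma integral_pow_mul_poissonWeight (k m : ℕ) :
    ∫ t in Set.Ioi (0 : ℝ), t ^ k * poissonWeight t m = (k + m).factorial / m.factorial := by
  rw [← Real.Gamma_nat_eq_factorial, Real.Gamma_eq_integral (by positivity),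
    ← integral_div]
  refine setIntegral_congr_fun measurableSet_Ioi fun t _ => ?_
  rw [add_sub_cancel_right, Real.rpow_natCast, poissonWeight, pow_add]
  ring

lemma integral_pow_mul_tsum (k : ℕ) {d : ℕ → ℝ} (hd : ∀ m, 0 ≤ d m)
    (hs : Summable fun m : ℕ => ((k + m).factorial / m.factorial : ℝ) * d m) :
    ∫ t in Set.Ioi (0 : ℝ), t ^ k * ∑' m, poissonWeight t m * d m
      = ∑' m : ℕ, ((k + m).factorial / m.factorial : ℝ) * d m := by
  have h := integral_tsum_of_summable_integral_norm (μ := volume.restrict (Set.Ioi (0 : ℝ)))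
    (F := fun (m : ℕ) (t : ℝ) => t ^ k * poissonWeight t m * d m)
    (fun m => (integrableOn_pow_mul_poissonWeight k m).mul_const _) (hs.congr fun m => ?_)
  · simp only [integral_mul_const, integral_pow_mul_poissonWeight] at h
    simp only [mul_assoc, tsum_mul_left] at h
    exact h.symm
  · rw [← integral_pow_mul_poissonWeight, ← integral_mul_const]
    refine setIntegral_congr_fun measurableSet_Ioi fun t ht => ?_
    have ht' : (0 : ℝ) ≤ t := (Set.mem_Ioi.mp ht).le
    exact (Real.norm_of_nonneg (mul_nonneg (mul_nonneg (pow_nonneg ht' k)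
      (poissonWeight_nonneg ht' m)) (hd m))).symm

lemma hitMeanC_eq_hitMean (c : BDChain n) (M x : Fin (n + 1)) :
    c.hitMeanC M x = c.hitMean M x := by
  have e : ∀ m : ℕ, (((0 + m).factorial : ℝ) / m.factorial) = 1 := fun m => by
    rw [zero_add, div_self (by positivity)]
  have h := integral_pow_mul_tsum 0 (c.hitSurv_nonneg M x)
    (by simpa only [e, one_mul] using c.summable_hitSurv M x)
  simp only [e, pow_zero, one_mul] at h
  exact h

lemma hitVarC_eq_varSum (c : BDChain n) (M : Fin (n + 1)) :
    c.hitVarC M 0 = c.varSum M := by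
  have e : ∀ m : ℕ, (((1 + m).factorial : ℝ) / m.factorial) = m + 1 := by
    intro m
    rw [add_comm, Nat.factorial_succ]
    push_cast
    have : (m.factorial : ℝ) ≠ 0 := by positivity
    field_simp
  have h := integral_pow_mul_tsum 1 (c.hitSurv_nonneg M 0)
    (by simpa only [e] using c.summable_succ_mul_hitSurv M 0)
  simp only [e, pow_one] at h
  rw [← hitVar_add_hitMean_eq_varSum, hitVar_add_hitMean, hitVarC, hitMeanC_eq_hitMean, hitPot, ← h,
    ← integral_const_mul]
  congr 1
  refine integral_congr_ae (ae_of_all _ fun t => ?_)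
  simp only [mul_assoc]
  rfl

/-! ### The lazy chain -/

/-- The chain with half the moves suppressed. -/
def lazy (c : BDChain n) : BDChain n where
  K := (2⁻¹ : ℝ) • (1 + c.K)
  pi := c.pi
  K_nonneg i j := by
    have := c.K_nonneg i j
    rw [Matrix.smul_apply, Matrix.add_apply, Matrix.one_apply, smul_eq_mul]
    split_ifs <;> positivity
  K_rowSum i := by
    simp only [Matrix.smul_apply, Matrix.add_apply, smul_eq_mul, ← Finset.mul_sum,
      Finset.sum_add_distrib, c.K_rowSum]
    simp [Matrix.one_apply]; norm_num
  K_tridiag i j h := by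
    have hij : i ≠ j := by rintro rfl; simp at h
    simp [hij, c.K_tridiag i j h]
  K_irred i h := by
    have := c.K_irred i h
    simp [this]
  pi_pos := c.pi_pos
  pi_sum := c.pi_sum
  pi_stat j := by
    simp only [Matrix.smul_apply, Matrix.add_apply, smul_eq_mul, mul_left_comm _ (2⁻¹ : ℝ),
      ← Finset.mul_sum, mul_add, Finset.sum_add_distrib, c.pi_stat]
    simp [Matrix.one_apply]; ring

lemma half_le_lazy_K (c : BDChain n) (i : Fin (n + 1)) : 1 / 2 ≤ c.lazy.K i i := by
  have := c.K_nonneg i i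
  simp only [lazy, Matrix.smul_apply, Matrix.add_apply, Matrix.one_apply_eq, smul_eq_mul]
  linarith

lemma lazy_edgeRes (c : BDChain n) (l : ℕ) : c.lazy.edgeRes l = 2 * c.edgeRes l := by
  rw [edgeRes, edgeRes]
  split_ifs with h
  · simp [lazy]; ring
  · simp

lemma lazy_hitMean (c : BDChain n) (M : Fin (n + 1)) :
    c.lazy.hitMean M 0 = 2 * c.hitMean M 0 := by
  rw [hitMean_eq_sum, hitMean_eq_sum, Finset.mul_sum]
  refine Finset.sum_congr rfl fun l _ => ?_
  rw [lazy_edgeRes, mul_assoc]; rfl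

lemma lazy_varSum (c : BDChain n) (M : ℕ) : c.lazy.varSum M = 2 ^ 2 * c.varSum M := by
  rw [varSum, varSum, Finset.mul_sum]
  refine Finset.sum_congr rfl fun l _ => ?_
  have h : ∑ i ∈ Finset.range (l + 1), c.lazy.edgeRes i * c.lazy.cumMass i ^ 2
      = 2 * ∑ i ∈ Finset.range (l + 1), c.edgeRes i * c.cumMass i ^ 2 := by
    rw [Finset.mul_sum]
    exact Finset.sum_congr rfl fun i _ => by rw [lazy_edgeRes, mul_assoc]; rfl
  have h' : c.lazy.cumMass l = c.cumMass l := rfl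
  rw [h, h', lazy_edgeRes]; ring

lemma lazy_K_pow_apply (c : BDChain n) (m : ℕ) (x y : Fin (n + 1)) :
    2 ^ m * (c.lazy.K ^ m) x y
      = ∑ p ∈ Finset.HasAntidiagonal.antidiagonal m, (m.choose p.1 : ℝ) * (c.K ^ p.1) x y := by
  have h : (2 : ℝ) ^ m • c.lazy.K ^ m = (c.K + 1) ^ m := by
    rw [← _root_.smul_pow, lazy, smul_smul, mul_inv_cancel₀ two_ne_zero, one_smul, add_comm 1 c.K]
  have h' := congrFun (congrFun h x) y
  rw [(Commute.one_right c.K).add_pow'] at h'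
  simp only [Matrix.sum_apply, Matrix.smul_apply, mul_one, one_pow, smul_eq_mul] at h'
  simpa only [nsmul_eq_mul] using h'

lemma abs_K_pow_le_one (c : BDChain n) (m : ℕ) (x y : Fin (n + 1)) : |(c.K ^ m) x y| ≤ 1 := by
  rw [abs_of_nonneg (c.K_pow_nonneg m x y)]
  simpa using c.sum_K_pow_le_one m x {y}

lemma Ht_eq_tsum_lazy (c : BDChain n) {t : ℝ} (ht : 0 ≤ t) (x y : Fin (n + 1)) :
    c.Ht t x y = ∑' m, poissonWeight (2 * t) m * (c.lazy.K ^ m) x y := by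
  have h1 := summable_poissonWeight_mul ht fun m => c.abs_K_pow_le_one m x y
  have h := tsum_mul_tsum_eq_tsum_sum_antidiagonal_of_summable_norm
    h1.norm (hasSum_poissonWeight t).summable.norm
  rw [(hasSum_poissonWeight t).tsum_eq, mul_one] at h
  refine Eq.trans h (tsum_congr fun m => ?_)
  have e : poissonWeight (2 * t) m * (c.lazy.K ^ m) x y
      = Real.exp (-t) * Real.exp (-t) * t ^ m / m.factorial * (2 ^ m * (c.lazy.K ^ m) x y) := by
    rw [poissonWeight, ← Real.exp_add, mul_pow]; ring_nf
  rw [e, lazy_K_pow_apply, Finset.mul_sum]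
  refine Finset.sum_congr rfl fun p hp => ?_
  obtain rfl := Finset.HasAntidiagonal.mem_antidiagonal.mp hp
  rw [Nat.cast_add_choose, poissonWeight, poissonWeight, pow_add]
  have h1 : (p.1.factorial : ℝ) ≠ 0 := by positivity
  have h2 : (p.2.factorial : ℝ) ≠ 0 := by positivity
  have h3 : ((p.1 + p.2).factorial : ℝ) ≠ 0 := by positivity
  field_simp

lemma abs_dev_le_one (c : BDChain n) (A : Finset (Fin (n + 1))) (m : ℕ) (x : Fin (n + 1)) :
    |c.dev A m x| ≤ 1 := abs_le.mpr ⟨c.neg_one_le_dev A m x, c.dev_le_one A m x⟩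

lemma sum_Ht_sub_eq (c : BDChain n) {t : ℝ} (ht : 0 ≤ t) (A : Finset (Fin (n + 1)))
    (x : Fin (n + 1)) : ∑ y ∈ A, c.Ht t x y - ∑ y ∈ A, c.pi y
      = ∑' m, poissonWeight (2 * t) m * c.lazy.dev A m x := by
  have ht2 : 0 ≤ 2 * t := by positivity
  have h1 : ∀ y ∈ A, Summable fun m => poissonWeight (2 * t) m * (c.lazy.K ^ m) x y :=
    fun y _ => summable_poissonWeight_mul ht2 fun m => c.lazy.abs_K_pow_le_one m x y
  have h2 : ∑ y ∈ A, c.Ht t x y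
      = ∑' m, poissonWeight (2 * t) m * ∑ y ∈ A, (c.lazy.K ^ m) x y := by
    simp only [c.Ht_eq_tsum_lazy ht, Finset.mul_sum]
    rw [Summable.tsum_finsetSum h1]
  have h3 : Summable fun m => poissonWeight (2 * t) m * ∑ y ∈ A, (c.lazy.K ^ m) x y := by
    simpa only [Finset.mul_sum] using summable_sum h1
  have h4 := (hasSum_poissonWeight (2 * t)).mul_right (∑ y ∈ A, c.pi y)
  rw [one_mul] at h4
  rw [h2, ← h4.tsum_eq, ← Summable.tsum_sub h3 h4.summable]
  exact tsum_congr fun m => (mul_sub _ _ _).symm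

/-! ### Mixing times -/

/-- Deviation bound `3ε / 4` beyond `E_0 τ_M + 2 L b + 1`. -/
lemma dev_le_of_sqrt_varSum_le (c : BDChain n) {δ : ℝ} (hδ0 : 0 < δ) (hδ1 : δ < 1)
    (hδ : ∀ i, δ ≤ c.K i i) (A : Finset (Fin (n + 1))) {ε : ℝ} (hε0 : 0 < ε) (hε1 : ε < 1)
    {j M : Fin (n + 1)} (hj : 1 - ε / 8 ≤ c.piHigh j) (hM : 1 - ε / 8 ≤ c.piLow M)
    (hja : ε / 8 ≤ c.piLow j) {C b L : ℝ} (hC : 0 < C) (hb : 0 < b)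
    (hV : √(c.varSum M) ≤ C * b) (hL : L = 4 * C / (ε / 8 * δ * ε)) {m : ℕ}
    (hm : c.hitMean M 0 + 2 * L * b + 1 ≤ m) : c.dev A m 0 ≤ 3 / 4 * ε := by
  have hL0 : 0 < L := by rw [hL]; positivity
  have hCL : C = ε / 8 * δ * ε / 4 * L := by rw [hL]; field_simp
  have hLb : 0 < L * b := by positivity
  have hr : 0 < ⌈L * b⌉₊ := Nat.ceil_pos.mpr hLb
  have hr1 := Nat.le_ceil (L * b)
  have hr2 := Nat.ceil_lt_add_one hLb.le
  have h := c.dev_le_of_hitMean_add_le hδ0 hδ1 hδ A hr j M (by positivity) hj hM (by positivity)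
    hja hLb (m := m) (by linarith)
  have h1 : √(c.varSum M) / (ε / 8 * (δ * ⌈L * b⌉₊)) ≤ ε / 4 := by
    rw [div_le_iff₀ (by positivity)]
    refine hV.trans ?_
    calc C * b = ε / 4 * (ε / 8 * (δ * (L * b))) := by rw [hCL]; ring
      _ ≤ _ := by gcongr
  have h2 : c.varSum M / (L * b) ^ 2 ≤ ε / 4 := by
    rw [div_le_iff₀ (by positivity), ← Real.sq_sqrt (c.varSum_nonneg M)]
    refine (pow_le_pow_left₀ (Real.sqrt_nonneg _) hV 2).trans ?_
    calc (C * b) ^ 2 = (ε / 8 * δ * ε / 4) ^ 2 * (L * b) ^ 2 := by rw [hCL]; ring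
      _ ≤ ε / 4 * (L * b) ^ 2 := by
        refine mul_le_mul_of_nonneg_right ?_ (by positivity)
        have h3 : ε / 8 * δ * ε / 4 ≤ ε / 4 := by
          have : ε * δ ≤ 1 := mul_le_one₀ hε1.le hδ0.le hδ1.le
          nlinarith
        have h4 : 0 ≤ ε / 8 * δ * ε / 4 := by positivity
        nlinarith
  linarith

/-- Deviation lower bound up to `E_0 τ_M - L b`. -/
lemma le_dev_of_sqrt_varSum_le (c : BDChain n) {ε : ℝ} (hε0 : 0 < ε) (hε1 : ε < 1)
    {M : Fin (n + 1)} (hM : (1 + ε) / 2 ≤ c.piHigh M) {C b L : ℝ} (hC : 0 < C) (hb : 0 < b)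
    (hV : √(c.varSum M) ≤ C * b) (hL : L = 4 * C / (1 - ε)) {m : ℕ}
    (hm : m + L * b ≤ c.hitMean M 0) :
    ε + (1 - ε) / 4 ≤ c.dev {y | y < M} m 0 := by
  have hε : 0 < 1 - ε := by linarith
  have hL0 : 0 < L := by rw [hL]; positivity
  have hCL : C = (1 - ε) / 4 * L := by rw [hL]; field_simp
  have h := c.le_dev_of_add_le_hitMean M (by positivity) hm
  have h2 : c.varSum M / (L * b) ^ 2 ≤ (1 - ε) / 4 := by
    rw [div_le_iff₀ (by positivity), ← Real.sq_sqrt (c.varSum_nonneg M)]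
    refine (pow_le_pow_left₀ (Real.sqrt_nonneg _) hV 2).trans ?_
    calc (C * b) ^ 2 = ((1 - ε) / 4) ^ 2 * (L * b) ^ 2 := by rw [hCL]; ring
      _ ≤ (1 - ε) / 4 * (L * b) ^ 2 := by
        refine mul_le_mul_of_nonneg_right ?_ (by positivity)
        nlinarith
  linarith

lemma dev_zero_le (c : BDChain n) (A : Finset (Fin (n + 1))) :
    c.dev A 0 0 ≤ 1 - c.piLow 0 := by
  have h0 : c.piLow 0 = c.pi 0 := by
    rw [piLow, Finset.sum_eq_single 0] <;> simp +contextual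
  rw [h0, dev]
  by_cases h : (0 : Fin (n + 1)) ∈ A
  · have h1 := Finset.single_le_sum (fun y _ => (c.pi_pos y).le) h
    have h2 := c.sum_K_pow_le_one 0 0 A
    linarith
  · have h1 : ∑ y ∈ A, (c.K ^ 0) 0 y = 0 := Finset.sum_eq_zero fun y hy => by
      rw [pow_zero, Matrix.one_apply_ne]
      rintro rfl; exact h hy
    have h2 := c.sum_pi_nonneg A
    have h3 : c.pi 0 ≤ 1 := by
      rw [← c.pi_sum]
      exact Finset.single_le_sum (fun y _ => (c.pi_pos y).le) (Finset.mem_univ 0)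
    linarith

lemma dev_le_dTV (c : BDChain n) (A : Finset (Fin (n + 1))) (m : ℕ) (x : Fin (n + 1)) :
    c.dev A m x ≤ c.dTV x m :=
  le_ciSup (f := fun A => c.dev A m x) (Set.finite_range _).bddAbove A

lemma sum_Ht_sub_le_dTVC (c : BDChain n) (A : Finset (Fin (n + 1))) (t : ℝ) (x : Fin (n + 1)) :
    ∑ y ∈ A, c.Ht t x y - ∑ y ∈ A, c.pi y ≤ c.dTVC x t :=
  le_ciSup (f := fun A : Finset (Fin (n + 1)) => ∑ y ∈ A, c.Ht t x y - ∑ y ∈ A, c.pi y)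
    (Set.finite_range _).bddAbove A

lemma mixD_eq_zero (c : BDChain n) {a : ℝ} (h : a ≤ c.piLow 0) :
    mixD (c.dTV 0) (1 - a) = 0 :=
  Nat.sInf_eq_zero.mpr <| Or.inl <| ciSup_le fun A => (c.dev_zero_le A).trans (by linarith)

lemma mixC_eq_zero (c : BDChain n) {a : ℝ} (h : a ≤ c.piLow 0) :
    mixC (c.dTVC 0) (1 - a) = 0 := by
  refine IsLeast.csInf_eq ⟨⟨le_rfl, ciSup_le fun A => ?_⟩, fun t ht => ht.1⟩
  rw [c.sum_Ht_sub_eq le_rfl, tsum_eq_single 0 fun m hm => by simp [poissonWeight, hm]]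
  simp only [poissonWeight, mul_zero, neg_zero, Real.exp_zero, pow_zero, Nat.factorial_zero,
    Nat.cast_one, mul_one, div_one, one_mul]
  refine (c.lazy.dev_zero_le A).trans ?_
  rw [show c.lazy.piLow 0 = c.piLow 0 from rfl]
  linarith

lemma exists_dTV_le (c : BDChain n) {δ : ℝ} (hδ0 : 0 < δ) (hδ1 : δ < 1)
    (hδ : ∀ i, δ ≤ c.K i i) {ε : ℝ} (hε0 : 0 < ε) (hε1 : ε < 1)
    {j M : Fin (n + 1)} (hj : 1 - ε / 8 ≤ c.piHigh j) (hM : 1 - ε / 8 ≤ c.piLow M)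
    (hja : ε / 8 ≤ c.piLow j) {C b L : ℝ} (hC : 0 < C) (hb : 0 < b)
    (hV : √(c.varSum M) ≤ C * b) (hL : L = 4 * C / (ε / 8 * δ * ε)) :
    ∃ m : ℕ, c.dTV 0 m ≤ ε ∧ m ≤ c.hitMean M 0 + 2 * L * b + 2 := by
  have hu : 0 ≤ c.hitMean M 0 := tsum_nonneg (c.hitSurv_nonneg M 0)
  have hL0 : 0 < L := by rw [hL]; positivity
  refine ⟨⌈c.hitMean M 0 + 2 * L * b + 1⌉₊, ciSup_le fun A => ?_, ?_⟩
  · have := c.dev_le_of_sqrt_varSum_le hδ0 hδ1 hδ A hε0 hε1 hj hM hja hC hb hV hL (Nat.le_ceil _)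
    rw [dev] at this
    linarith
  · have := Nat.ceil_lt_add_one (show 0 ≤ c.hitMean M 0 + 2 * L * b + 1 by positivity)
    linarith

lemma sub_le_of_dTV_le (c : BDChain n) {ε : ℝ} (hε0 : 0 < ε) (hε1 : ε < 1)
    {M : Fin (n + 1)} (hM : (1 + ε) / 2 ≤ c.piHigh M) {C b L : ℝ} (hC : 0 < C) (hb : 0 < b)
    (hV : √(c.varSum M) ≤ C * b) (hL : L = 4 * C / (1 - ε)) {m : ℕ} (hm : c.dTV 0 m ≤ ε) :
    c.hitMean M 0 - L * b ≤ m := by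
  by_contra! h
  have := c.le_dev_of_sqrt_varSum_le hε0 hε1 hM hC hb hV hL (m := m) (by linarith)
  have := c.dev_le_dTV {y | y < M} m 0
  linarith

lemma sqrt_lazy_varSum_le (c : BDChain n) {M : ℕ} {C b : ℝ} (hV : √(c.varSum M) ≤ C * b) :
    √(c.lazy.varSum M) ≤ 2 * C * b := by
  rw [lazy_varSum, Real.sqrt_mul (by positivity), Real.sqrt_sq zero_le_two]
  linarith

lemma exists_dTVC_le (c : BDChain n) {ε : ℝ} (hε0 : 0 < ε) (hε1 : ε < 1)
    {j M : Fin (n + 1)} (hj : 1 - ε / 8 ≤ c.piHigh j) (hM : 1 - ε / 8 ≤ c.piLow M)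
    (hja : ε / 8 ≤ c.piLow j) {C b L H : ℝ} (hC : 0 < C) (hb : 0 < b)
    (hV : √(c.varSum M) ≤ C * b) (hCb : 1 ≤ C * b)
    (hL : L = 4 * (2 * C) / (ε / 8 * (1 / 2) * ε))
    (hH : H = 1 + 4 * (3 * C ^ 2 + 2 * L * C + C) / ε) :
    ∃ t : ℝ, (0 ≤ t ∧ c.dTVC 0 t ≤ ε) ∧ t = c.hitMean M 0 + (L + C / 2 + H / 2) * b := by
  have hu : 0 ≤ c.hitMean M 0 := tsum_nonneg (c.hitSurv_nonneg M 0)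
  have hL0 : 0 < L := by rw [hL]; positivity
  have hH0 : 1 ≤ H := by rw [hH]; simp only [le_add_iff_nonneg_right]; positivity
  have huV : c.hitMean M 0 ≤ (C * b) ^ 2 := by
    refine (c.hitMean_le_varSum M).trans ?_
    rw [← Real.sq_sqrt (c.varSum_nonneg M)]
    exact pow_le_pow_left₀ (Real.sqrt_nonneg _) hV 2
  set t := c.hitMean M 0 + (L + C / 2 + H / 2) * b with ht
  have ht0 : 0 ≤ t := by positivity
  refine ⟨t, ⟨ht0, ciSup_le fun A => ?_⟩, rfl⟩
  rw [c.sum_Ht_sub_eq ht0]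
  have hHb : 0 < H * b := by positivity
  refine (tsum_poissonWeight_mul_le (by positivity) (fun m => c.lazy.abs_dev_le_one A m 0)
    (β := 3 / 4 * ε) hHb (fun m => ?_) fun m => ?_).trans ?_
  · linarith [c.lazy.dev_le_one A m 0]
  · by_cases hm : 2 * t - H * b ≤ m
    · left
      refine c.lazy.dev_le_of_sqrt_varSum_le (by norm_num) (by norm_num) c.half_le_lazy_K A hε0
        hε1 hj hM hja (by positivity) hb (c.sqrt_lazy_varSum_le hV) hL ?_
      rw [lazy_hitMean]
      nlinarith
    · right
      rw [← neg_sub, neg_sq]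
      exact pow_le_pow_left₀ hHb.le (by linarith) 2
  · have h1 : 2 * t ≤ (3 * C ^ 2 + 2 * L * C + C) * H * b ^ 2 := by
      have h2 : (2 * L + C + H) * b ≤ (2 * L + C + H) * b * (C * b) :=
        le_mul_of_one_le_right (by positivity) hCb
      have h3 : 0 ≤ (H - 1) * (3 * C ^ 2 + 2 * L * C) * b ^ 2 :=
        mul_nonneg (mul_nonneg (by linarith) (by positivity)) (by positivity)
      nlinarith
    have h4 : 2 * t / (H * b) ^ 2 ≤ ε / 4 := by
      rw [div_le_iff₀ (by positivity)]
      refine h1.trans ?_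
      have h5 : 3 * C ^ 2 + 2 * L * C + C = ε / 4 * (H - 1) := by rw [hH]; field_simp; ring
      rw [h5]
      have : 0 ≤ ε / 4 * H * b ^ 2 := by positivity
      nlinarith
    linarith

lemma sub_le_of_dTVC_le (c : BDChain n) {ε : ℝ} (hε0 : 0 < ε) (hε1 : ε < 1)
    {M : Fin (n + 1)} (hM : (1 + ε) / 2 ≤ c.piHigh M) {C b L H : ℝ} (hC : 0 < C) (hb : 0 < b)
    (hV : √(c.varSum M) ≤ C * b) (hL : L = 4 * (2 * C) / (1 - ε)) (hH : H = 4 * C / (1 - ε))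
    {t : ℝ} (ht : 0 ≤ t ∧ c.dTVC 0 t ≤ ε) :
    c.hitMean M 0 - (L + H) / 2 * b ≤ t := by
  obtain ⟨ht0, ht⟩ := ht
  by_contra! h
  have hε : 0 < 1 - ε := by linarith
  have hL0 : 0 < L := by rw [hL]; positivity
  have hH0 : 0 < H := by rw [hH]; positivity
  have huV : c.hitMean M 0 ≤ (C * b) ^ 2 := by
    refine (c.hitMean_le_varSum M).trans ?_
    rw [← Real.sq_sqrt (c.varSum_nonneg M)]
    exact pow_le_pow_left₀ (Real.sqrt_nonneg _) hV 2
  have hHb : 0 < H * b := by positivity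
  have h1 := tsum_poissonWeight_mul_le (s := 2 * t) (by positivity)
    (d := fun m => -c.lazy.dev {y | y < M} m 0)
    (fun m => (abs_neg _).trans_le (c.lazy.abs_dev_le_one _ m 0))
    (β := -(ε + (1 - ε) / 4)) hHb (fun m => ?_) fun m => ?_
  · simp only [mul_neg, tsum_neg] at h1
    rw [← c.sum_Ht_sub_eq ht0] at h1
    have h2 := c.sum_Ht_sub_le_dTVC {y | y < M} t 0
    have h3 : 2 * t / (H * b) ^ 2 < (1 - ε) / 4 := by
      rw [div_lt_iff₀ (by positivity)]
      have h4 : C = (1 - ε) / 4 * H := by rw [hH]; field_simp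
      have h5 : (C * b) ^ 2 = ((1 - ε) / 4) ^ 2 * (H * b) ^ 2 := by rw [h4]; ring
      have h6 : 0 < (L + H) / 2 * b := by positivity
      nlinarith [show 0 < (H * b) ^ 2 by positivity]
    linarith
  · have h2 := c.lazy.sum_pi_lt M
    have h3 : c.lazy.piHigh M = c.piHigh M := rfl
    have h4 := c.lazy.sum_K_pow_nonneg m 0 {y | y < M}
    rw [dev]
    linarith
  · by_cases hm : (m : ℝ) ≤ 2 * t + H * b
    · left
      refine neg_le_neg (c.lazy.le_dev_of_sqrt_varSum_le hε0 hε1 hM (by positivity) hb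
        (c.sqrt_lazy_varSum_le hV) hL ?_)
      rw [lazy_hitMean]
      linarith
    · right
      exact pow_le_pow_left₀ hHb.le (by linarith) 2

/-- Bounds on mixing times by mean hitting times at suitable levels give a cutoff window. -/
lemma cutoffWindow_of_bounds (F : (n : ℕ) → BDChain n) (M : ℝ → (n : ℕ) → Fin (n + 1))
    (hM : ∀ a ∈ Set.Ioo (0 : ℝ) 1, ∀ n, a ≤ (F n).piLow (M a n))
    {T : ℝ → ℕ → ℝ} {u : ℝ → ℕ → ℝ} {b : ℕ → ℝ} (hb : ∀ n, 0 < b n)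
    (hu : ∀ a n, u a n = (F n).hitMean (M a n) 0)
    (hub : ∀ a ∈ Set.Ioo (0 : ℝ) 1, Tendsto (fun n => b n / u a n) atTop (nhds 0))
    (hV : ∀ a ∈ Set.Ioo (0 : ℝ) 1, ∃ C : ℝ, ∀ᶠ n in atTop, √((F n).varSum (M a n)) ≤ C * b n)
    (hpos : ∀ a ∈ Set.Ioo (0 : ℝ) 1, ∀ᶠ n in atTop, M a n ≠ 0)
    (hupper : ∀ ε ∈ Set.Ioo (0 : ℝ) 1, ∃ a ∈ Set.Ioo (0 : ℝ) 1, ∃ C : ℝ, ∀ᶠ n in atTop,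
      T ε n ≤ (F n).hitMean (M a n) 0 + C * b n)
    (hlower : ∀ ε ∈ Set.Ioo (0 : ℝ) 1, ∃ a ∈ Set.Ioo (0 : ℝ) 1, ∃ C : ℝ, ∀ᶠ n in atTop,
      (F n).hitMean (M a n) 0 - C * b n ≤ T ε n) :
    ∀ a ∈ Set.Ioo (0 : ℝ) 1, cutoffWindow T (u a) b := by
  have hcomp : ∀ a ∈ Set.Ioo (0 : ℝ) 1, ∀ a' ∈ Set.Ioo (0 : ℝ) 1, ∃ C : ℝ, ∀ᶠ n in atTop,
      |(F n).hitMean (M a n) 0 - (F n).hitMean (M a' n) 0| ≤ C * b n := by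
    intro a ha a' ha'
    obtain ⟨C, hC⟩ := hV a ha
    obtain ⟨C', hC'⟩ := hV a' ha'
    have hmin : 0 < min a a' := lt_min ha.1 ha'.1
    refine ⟨(C + C') / min a a', ?_⟩
    filter_upwards [hC, hC'] with n h h'
    refine ((F n).abs_hitMean_sub_le _ _ hmin ((min_le_left _ _).trans (hM a ha n))
      ((min_le_right _ _).trans (hM a' ha' n))).trans ?_
    rw [div_mul_eq_mul_div]
    gcongr
    linarith
  intro a ha
  refine ⟨?_, Eventually.of_forall hb, hub a ha, fun ε hε => ?_⟩
  · filter_upwards [hpos a ha] with n hn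
    rw [hu]
    refine lt_of_lt_of_le ?_ ((F n).le_hitMean (M a n))
    exact_mod_cast Fin.pos_iff_ne_zero.mpr hn
  · obtain ⟨a₁, ha₁, C₁, h₁⟩ := hupper ε hε
    obtain ⟨a₂, ha₂, C₂, h₂⟩ := hlower ε hε
    obtain ⟨C₃, h₃⟩ := hcomp a ha a₁ ha₁
    obtain ⟨C₄, h₄⟩ := hcomp a ha a₂ ha₂
    refine ⟨max (C₁ + C₃) (C₂ + C₄), ?_⟩
    filter_upwards [h₁, h₂, h₃, h₄] with n h₁ h₂ h₃ h₄
    have h₅ := mul_le_mul_of_nonneg_right (le_max_left (C₁ + C₃) (C₂ + C₄)) (hb n).le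
    have h₆ := mul_le_mul_of_nonneg_right (le_max_right (C₁ + C₃) (C₂ + C₄)) (hb n).le
    rw [abs_le] at h₃ h₄
    rw [hu, abs_le]
    constructor <;> linarith

lemma exists_pos_eventually_le {f b : ℕ → ℝ} (hb : ∀ n, 0 < b n)
    (h : ∃ C : ℝ, ∀ᶠ n in atTop, f n ≤ C * b n) :
    ∃ C : ℝ, 0 < C ∧ ∀ᶠ n in atTop, f n ≤ C * b n := by
  obtain ⟨C, hC⟩ := h
  refine ⟨max C 1, lt_max_of_lt_right one_pos, hC.mono fun n hn => hn.trans ?_⟩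
  exact mul_le_mul_of_nonneg_right (le_max_left C 1) (hb n).le

lemma eventually_ne_zero_of_hasCutoff {T : ℝ → ℕ → ℝ} (h : hasCutoff T) {ε : ℝ}
    (hε : ε ∈ Set.Ioo (0 : ℝ) 1) : ∀ᶠ n in atTop, T ε n ≠ 0 := by
  obtain ⟨t, -, ht⟩ := h
  filter_upwards [(ht ε hε).eventually_ne one_ne_zero] with n hn h0
  exact hn (by rw [h0, zero_div])

lemma eventually_M_ne_zero (F : (n : ℕ) → BDChain n) (M : ℝ → (n : ℕ) → Fin (n + 1))
    (hM : ∀ a ∈ Set.Ioo (0 : ℝ) 1, ∀ n, a ≤ (F n).piLow (M a n))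
    {T : ℝ → ℕ → ℝ} (hT : hasCutoff T)
    (h0 : ∀ a n, a ≤ (F n).piLow 0 → T (1 - a) n = 0) :
    ∀ a ∈ Set.Ioo (0 : ℝ) 1, ∀ᶠ n in atTop, M a n ≠ 0 := by
  intro a ha
  have ha' : 1 - a ∈ Set.Ioo (0 : ℝ) 1 := ⟨by linarith [ha.2], by linarith [ha.1]⟩
  filter_upwards [eventually_ne_zero_of_hasCutoff hT ha'] with n hn h
  exact hn (h0 a n (h ▸ hM a ha n))

end BDChain

/-- Corollary `c-tv`.  If `F_c^L` has a total variation cutoff and `b_n > 0`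
satisfies `b_n = o(u_n(a))` and `v_n(a) = O(b_n)` for all `a ∈ (0,1)`, then `F_c^L` has a
`(u_n(a), b_n)` total variation cutoff for each `a`; the same holds for the discrete-time
family `F^L` under `inf_{n,i} K_n(i,i) > 0` and `inf_n b_n > 0`, with `w_n(a)` in place of
`v_n(a)`. -/
theorem birth_death_left_TV_cutoff_window
    (F : (n : ℕ) → BDChain n)
    (M : ℝ → (n : ℕ) → Fin (n + 1))
    (hM : ∀ a ∈ Set.Ioo (0 : ℝ) 1, ∀ n,
      a ≤ (F n).piLow (M a n) ∧ 1 - a ≤ (F n).piHigh (M a n))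
    (u v w : ℝ → ℕ → ℝ)
    (hu : ∀ a n, u a n = (F n).hitMeanC (M a n) 0)
    (hv : ∀ a n, v a n = Real.sqrt ((F n).hitVarC (M a n) 0))
    (hw : ∀ a n, w a n = Real.sqrt ((F n).hitVar (M a n) 0))
    (b : ℕ → ℝ) (hb : ∀ n, 0 < b n) :
    -- continuous-time case
    ((hasCutoff (fun ε n => mixC ((F n).dTVC 0) ε)) →
      (∀ a ∈ Set.Ioo (0 : ℝ) 1,
        Filter.Tendsto (fun n => b n / u a n) Filter.atTop (nhds 0)) →
      (∀ a ∈ Set.Ioo (0 : ℝ) 1, ∃ C : ℝ, ∀ᶠ n in Filter.atTop, v a n ≤ C * b n) →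
      ∀ a ∈ Set.Ioo (0 : ℝ) 1,
        cutoffWindow (fun ε n => mixC ((F n).dTVC 0) ε) (u a) b) ∧
    -- discrete-time case
    ((∃ δ > (0 : ℝ), ∀ n, ∀ i : Fin (n + 1), δ ≤ (F n).K i i) →
      (∃ c > (0 : ℝ), ∀ n, c ≤ b n) →
      (hasCutoff (fun ε n => ((mixD ((F n).dTV 0) ε : ℕ) : ℝ))) →
      (∀ a ∈ Set.Ioo (0 : ℝ) 1,
        Filter.Tendsto (fun n => b n / u a n) Filter.atTop (nhds 0)) →
      (∀ a ∈ Set.Ioo (0 : ℝ) 1, ∃ C : ℝ, ∀ᶠ n in Filter.atTop, w a n ≤ C * b n) →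
      ∀ a ∈ Set.Ioo (0 : ℝ) 1,
        cutoffWindow (fun ε n => ((mixD ((F n).dTV 0) ε : ℕ) : ℝ)) (u a) b) := by
  have hlow : ∀ a ∈ Set.Ioo (0 : ℝ) 1, ∀ n, a ≤ (F n).piLow (M a n) := fun a ha n => (hM a ha n).1
  have hu' : ∀ a n, u a n = (F n).hitMean (M a n) 0 := fun a n => by
    rw [hu, BDChain.hitMeanC_eq_hitMean]
  have hlevel : ∀ ε ∈ Set.Ioo (0 : ℝ) 1, ε / 8 ∈ Set.Ioo (0 : ℝ) 1 ∧
      1 - ε / 8 ∈ Set.Ioo (0 : ℝ) 1 ∧ (1 - ε) / 2 ∈ Set.Ioo (0 : ℝ) 1 := by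
    rintro ε ⟨h0, h1⟩
    refine ⟨⟨?_, ?_⟩, ⟨?_, ?_⟩, ?_, ?_⟩ <;> linarith
  refine ⟨fun hcut hub hvb => ?_, fun ⟨δ₀, hδ₀, hlazy⟩ ⟨c, hc, hcb⟩ hcut hub hwb => ?_⟩
  · have hV : ∀ a ∈ Set.Ioo (0 : ℝ) 1, ∃ C : ℝ, ∀ᶠ n in Filter.atTop,
        √((F n).varSum (M a n)) ≤ C * b n := by
      simpa only [hv, BDChain.hitVarC_eq_varSum] using hvb
    have hpos := BDChain.eventually_M_ne_zero F M hlow hcut fun a n => (F n).mixC_eq_zero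
    have hex : ∀ ε ∈ Set.Ioo (0 : ℝ) 1, ∃ C : ℝ, ∀ᶠ n in Filter.atTop, ∃ t : ℝ,
        (0 ≤ t ∧ (F n).dTVC 0 t ≤ ε) ∧ t = (F n).hitMean (M (1 - ε / 8) n) 0 + C * b n := by
      intro ε hε
      obtain ⟨h1, h2, -⟩ := hlevel ε hε
      obtain ⟨C, hC, hVC⟩ := BDChain.exists_pos_eventually_le hb (hV _ h2)
      obtain ⟨L, hL⟩ : ∃ L, L = 4 * (2 * C) / (ε / 8 * (1 / 2) * ε) := ⟨_, rfl⟩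
      obtain ⟨H, hH⟩ : ∃ H, H = 1 + 4 * (3 * C ^ 2 + 2 * L * C + C) / ε := ⟨_, rfl⟩
      refine ⟨L + C / 2 + H / 2, ?_⟩
      filter_upwards [hVC, hpos _ h2] with n hn hn0
      refine (F n).exists_dTVC_le hε.1 hε.2 (hM _ h1 n).2 (hM _ h2 n).1 (hM _ h1 n).1 hC (hb n)
        hn ?_ hL hH
      refine le_trans (Real.one_le_sqrt.mpr ?_) hn
      refine le_trans ?_ ((F n).hitMean_le_varSum _)
      refine le_trans ?_ ((F n).le_hitMean _)
      exact_mod_cast Fin.pos_iff_ne_zero.mpr hn0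
    refine BDChain.cutoffWindow_of_bounds F M hlow hb hu' hub hV hpos (fun ε hε => ?_)
      fun ε hε => ?_
    · obtain ⟨C, h⟩ := hex ε hε
      refine ⟨_, (hlevel ε hε).2.1, C, h.mono ?_⟩
      rintro n ⟨t, ht, rfl⟩
      exact csInf_le ⟨0, fun s hs => hs.1⟩ ht
    · obtain ⟨-, -, h3⟩ := hlevel ε hε
      obtain ⟨C, hC, hVC⟩ := BDChain.exists_pos_eventually_le hb (hV _ h3)
      obtain ⟨_, h⟩ := hex ε hε
      refine ⟨_, h3, (4 * (2 * C) / (1 - ε) + 4 * C / (1 - ε)) / 2, ?_⟩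
      filter_upwards [hVC, h] with n hn ⟨t, ht, _⟩
      refine le_csInf ⟨t, ht⟩ fun s hs => (F n).sub_le_of_dTVC_le hε.1 hε.2 ?_ hC (hb n) hn rfl
        rfl hs
      linarith [(hM _ h3 n).2]
  · obtain ⟨δ, hδ0, hδ1, hδ⟩ : ∃ δ : ℝ, 0 < δ ∧ δ < 1 ∧ ∀ n, ∀ i, δ ≤ (F n).K i i :=
      ⟨min δ₀ (1 / 2), lt_min hδ₀ (by norm_num), (min_le_right _ _).trans_lt (by norm_num),
        fun n i => (min_le_left _ _).trans (hlazy n i)⟩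
    have hV : ∀ a ∈ Set.Ioo (0 : ℝ) 1, ∃ C : ℝ, ∀ᶠ n in Filter.atTop,
        √((F n).varSum (M a n)) ≤ C * b n := by
      intro a ha
      obtain ⟨C, hC⟩ := hwb a ha
      refine ⟨C / √δ, hC.mono fun n hn => ?_⟩
      rw [div_mul_eq_mul_div, le_div_iff₀ (Real.sqrt_pos.mpr hδ0), mul_comm,
        ← Real.sqrt_mul hδ0.le]
      rw [hw] at hn
      exact (Real.sqrt_le_sqrt ((F n).mul_varSum_le_hitVar hδ1.le (hδ n) _)).trans hn
    have hpos := BDChain.eventually_M_ne_zero F M hlow hcut fun a n h => by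
      rw [(F n).mixD_eq_zero h, Nat.cast_zero]
    have hex : ∀ ε ∈ Set.Ioo (0 : ℝ) 1, ∃ C : ℝ, ∀ᶠ n in Filter.atTop, ∃ m : ℕ,
        (F n).dTV 0 m ≤ ε ∧ m ≤ (F n).hitMean (M (1 - ε / 8) n) 0 + C * b n := by
      intro ε hε
      obtain ⟨h1, h2, -⟩ := hlevel ε hε
      obtain ⟨C, hC, hVC⟩ := BDChain.exists_pos_eventually_le hb (hV _ h2)
      refine ⟨2 * (4 * C / (ε / 8 * δ * ε)) + 2 / c, hVC.mono fun n hn => ?_⟩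
      obtain ⟨m, hm, hm'⟩ := (F n).exists_dTV_le hδ0 hδ1 (hδ n) hε.1 hε.2 (hM _ h1 n).2
        (hM _ h2 n).1 (hM _ h1 n).1 hC (hb n) hn rfl
      have h4 : 2 ≤ 2 / c * b n := by
        rw [div_mul_eq_mul_div, le_div_iff₀ hc]
        linarith [hcb n]
      exact ⟨m, hm, by linarith⟩
    refine BDChain.cutoffWindow_of_bounds F M hlow hb hu' hub hV hpos (fun ε hε => ?_)
      fun ε hε => ?_
    · obtain ⟨C, h⟩ := hex ε hε
      refine ⟨_, (hlevel ε hε).2.1, C, h.mono ?_⟩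
      rintro n ⟨m, hm, hm'⟩
      exact le_trans (by exact_mod_cast Nat.sInf_le hm) hm'
    · obtain ⟨-, -, h3⟩ := hlevel ε hε
      obtain ⟨C, hC, hVC⟩ := BDChain.exists_pos_eventually_le hb (hV _ h3)
      obtain ⟨_, h⟩ := hex ε hε
      refine ⟨_, h3, 4 * C / (1 - ε), ?_⟩
      filter_upwards [hVC, h] with n hn ⟨m, hm, _⟩
      refine (F n).sub_le_of_dTV_le hε.1 hε.2 ?_ hC (hb n) hn rfl
        (Nat.sInf_mem (s := {m : ℕ | (F n).dTV 0 m ≤ ε}) ⟨m, hm⟩)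
      linarith [(hM _ h3 n).2]

end
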